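/- There is an absolute constant c > 0 such that for every simple graph G = (V,E) there is a set F of at most c·sqrt(pcr(G) + bds(G)) edges and a partition V = V_1 ∪ V_2 such that every edge of G between V_1 and V_2 lies in F, and the induced subgraphs G_1 = G[V_1] and G_2 = G[V_2] satisfy pcr(G_1) + bds(G_1) ≤ (3/4)(pcr(G) + bds(G)) and pcr(G_2) + bds(G_2) ≤ (3/4)(pcr(G) + bds(G)). -/

import Mathlib

open scoped BigOperators

/-- A drawing of a simple graph in the plane: vertices are distinct points, each edge is a
simple continuous curve joining its endpoints, not passing through any other vertex point;
two distinct edge curves share only finitely many points, and no three edge curves pass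
through a common interior point. -/
structure Drawing {V : Type*} (G : SimpleGraph V) where
  pos : V → ℝ × ℝ
  pos_inj : Function.Injective pos
  curve : G.edgeSet → ℝ → ℝ × ℝ
  curve_cont : ∀ e, ContinuousOn (curve e) (Set.Icc 0 1)
  curve_inj : ∀ e, Set.InjOn (curve e) (Set.Icc 0 1)
  curve_ends : ∀ e : G.edgeSet, ∃ u v : V, (e : Sym2 V) = s(u, v) ∧
    curve e 0 = pos u ∧ curve e 1 = pos v
  curve_avoid : ∀ (e : G.edgeSet), ∀ t ∈ Set.Ioo (0:ℝ) 1, curve e t ∉ Set.range pos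
  curve_finite_inter : ∀ e f : G.edgeSet, e ≠ f →
    (curve e '' Set.Icc 0 1 ∩ curve f '' Set.Icc 0 1).Finite
  no_triple_point : ∀ e f g : G.edgeSet, e ≠ f → f ≠ g → e ≠ g → ∀ p : ℝ × ℝ,
    ¬ (p ∈ curve e '' Set.Ioo 0 1 ∧ p ∈ curve f '' Set.Ioo 0 1 ∧ p ∈ curve g '' Set.Ioo 0 1)

namespace Drawing

variable {V : Type*} {G : SimpleGraph V} (D : Drawing G)

/-- `p` is a crossing point of the edges `e` and `f`: a common interior point of their curves. -/
def IsCross (e f : G.edgeSet) (p : ℝ × ℝ) : Prop :=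
  p ∈ D.curve e '' Set.Ioo 0 1 ∧ p ∈ D.curve f '' Set.Ioo 0 1

/-- The set of crossings of a drawing, recorded as (unordered pair of edges, crossing point). -/
def crossings : Set (Sym2 G.edgeSet × (ℝ × ℝ)) :=
  { x | ∃ e f : G.edgeSet, e ≠ f ∧ x.1 = s(e, f) ∧ D.IsCross e f x.2 }

/-- The number of crossings of a drawing. -/
noncomputable def numCrossings : ℕ := D.crossings.ncard

/-- The set of unordered pairs of distinct edges that cross each other. -/
def crossingPairs : Set (Sym2 G.edgeSet) :=
  { q | ∃ e f : G.edgeSet, e ≠ f ∧ q = s(e, f) ∧ ∃ p, D.IsCross e f p }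

/-- The number of pairs of edges that cross each other. -/
noncomputable def numCrossingPairs : ℕ := D.crossingPairs.ncard

/-- An edge participating in at least one crossing. -/
def CrossingEdge (e : G.edgeSet) : Prop :=
  ∃ f : G.edgeSet, e ≠ f ∧ ∃ p, D.IsCross e f p

/-- A drawing is straight-line if every edge is the line segment between its endpoints. -/
def IsStraightLine : Prop :=
  ∀ (e : G.edgeSet), ∀ t ∈ Set.Icc (0:ℝ) 1,
    D.curve e t = D.curve e 0 + t • (D.curve e 1 - D.curve e 0)

/-- A convex drawing: the vertices are in convex position and edges are straight segments. -/
def IsConvex : Prop :=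
  ConvexIndependent ℝ D.pos ∧ D.IsStraightLine

end Drawing

/-- The crossing number of a graph. -/
noncomputable def crNum {V : Type*} (G : SimpleGraph V) : ℕ :=
  sInf { n | ∃ D : Drawing G, D.numCrossings = n }

/-- The pair crossing number of a graph. -/
noncomputable def pcrNum {V : Type*} (G : SimpleGraph V) : ℕ :=
  sInf { n | ∃ D : Drawing G, D.numCrossingPairs = n }

/-- The sum of the squares of the degrees of a graph. -/
noncomputable def ssqd {V : Type*} (G : SimpleGraph V) : ℕ :=
  ∑ᶠ v : V, ((G.neighborSet v).ncard) ^ 2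

/-- The sum over all vertices of (degree choose 2). -/
noncomputable def bds {V : Type*} (G : SimpleGraph V) : ℕ :=
  ∑ᶠ v : V, ((G.neighborSet v).ncard).choose 2




namespace K33

open scoped unitInterval

lemma exists_log {A : Type} [TopologicalSpace A] [SimplyConnectedSpace A] [LocallyPathConnectedSpace A]
    (g : C(A, ℂ)) (hg : ∀ z, g z ≠ 0) : ∃ L : C(A, ℂ), ∀ z, Complex.exp (L z) = g z := by
  obtain ⟨a⟩ := (inferInstance : Nonempty A)
  obtain ⟨L, hL, -⟩ := Complex.isCoveringMapOn_exp.existsUnique_continuousMap_lifts g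
    (a₀ := a) (e₀ := Complex.log (g a)) (Complex.exp_log (hg a)) (fun z => hg z)
  exact ⟨L, fun z => congrFun hL.2 z⟩

lemma exists_log2 (g : C(I × I, ℂ)) (hg : ∀ z, g z ≠ 0) :
    ∃ L : C(I × I, ℂ), ∀ z, Complex.exp (L z) = g z := by
  obtain ⟨L, hL⟩ := exists_log (A := ℝ × ℝ) ⟨fun z => g (Set.projIcc 0 1 zero_le_one z.1,
    Set.projIcc 0 1 zero_le_one z.2), by
      have := continuous_projIcc (a := (0:ℝ)) (b := 1) (h := zero_le_one)
      fun_prop⟩ (fun z => hg _)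
  exact ⟨⟨fun z => L (z.1, z.2), by fun_prop⟩, fun z => by simp [hL]⟩

lemma exists_log1 (g : C(I, ℂ)) (hg : ∀ z, g z ≠ 0) :
    ∃ L : C(I, ℂ), ∀ z, Complex.exp (L z) = g z := by
  obtain ⟨L, hL⟩ := exists_log2 ⟨fun z => g z.1, by fun_prop⟩ (fun z => hg _)
  exact ⟨⟨fun z => L (z, 0), by fun_prop⟩, fun z => by simp [hL]⟩

lemma log_unique (L L' : C(I, ℂ)) (h : ∀ t, Complex.exp (L t) = Complex.exp (L' t)) :
    L 1 - L 0 = L' 1 - L' 0 := by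
  have := Complex.isCoveringMap_exp.eq_of_comp_eq (g₁ := fun t => L t)
    (g₂ := fun t => L' t + (L 0 - L' 0)) (by fun_prop) (by fun_prop) (by
      funext t
      apply Subtype.ext
      simp [Complex.exp_add, Complex.exp_sub, h]) 0 (by simp)
  have h1 := congrFun this 1
  replace h1 : L 1 = L' 1 + (L 0 - L' 0) := h1
  rw [h1]; ring

open Classical in
noncomputable def inc (x : ℂ) (γ : C(I, ℂ)) : ℂ :=
  if h : ∃ L : C(I, ℂ), ∀ t, Complex.exp (L t) = γ t - x then h.choose 1 - h.choose 0 else 0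

lemma inc_eq (x : ℂ) (γ L : C(I, ℂ)) (hL : ∀ t, Complex.exp (L t) = γ t - x) :
    inc x γ = L 1 - L 0 := by
  have h : ∃ L : C(I, ℂ), ∀ t, Complex.exp (L t) = γ t - x := ⟨L, hL⟩
  rw [inc, dif_pos h]
  exact log_unique _ _ fun t => by rw [h.choose_spec t, hL]

lemma inc_eq' (x : ℂ) (γ L : C(I, ℂ)) (hL : ∀ t, Complex.exp (L t) = x - γ t) :
    inc x γ = L 1 - L 0 := by
  have := inc_eq x γ (L + ContinuousMap.const _ (Real.pi * Complex.I)) (fun t => by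
    simp [Complex.exp_add, hL])
  rw [this]; simp

lemma square (γ δ : C(I, ℂ)) (h : ∀ s t, γ s ≠ δ t) :
    inc (δ 1) γ - inc (δ 0) γ = inc (γ 1) δ - inc (γ 0) δ := by
  obtain ⟨L, hL⟩ := exists_log2
    ⟨fun z => γ z.1 - δ z.2, by fun_prop⟩ (fun z => sub_ne_zero.2 (h _ _))
  simp only [ContinuousMap.coe_mk, Prod.forall] at hL
  rw [inc_eq (δ 1) γ ⟨fun s => L (s, 1), by fun_prop⟩ (fun t => by simp [hL]),
    inc_eq (δ 0) γ ⟨fun s => L (s, 0), by fun_prop⟩ (fun t => by simp [hL]),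
    inc_eq' (γ 1) δ ⟨fun s => L (1, s), by fun_prop⟩ (fun t => by simp [hL]),
    inc_eq' (γ 0) δ ⟨fun s => L (0, s), by fun_prop⟩ (fun t => by simp [hL])]
  simp only [ContinuousMap.coe_mk]
  ring

lemma inc_int (x : ℂ) (γ : C(I, ℂ)) (h : ∀ t, γ t ≠ x) (l0 l1 : ℂ)
    (h0 : Complex.exp l0 = γ 0 - x) (h1 : Complex.exp l1 = γ 1 - x) :
    ∃ n : ℤ, inc x γ = l1 - l0 + n * (2 * Real.pi * Complex.I) := by
  obtain ⟨L, hL⟩ := exists_log1 ⟨fun z => γ z - x, by fun_prop⟩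
    (fun z => sub_ne_zero.2 (h _))
  rw [inc_eq x γ L hL]
  obtain ⟨n, hn⟩ := Complex.exp_eq_exp_iff_exists_int.1 ((hL 0).trans h0.symm)
  obtain ⟨m, hm⟩ := Complex.exp_eq_exp_iff_exists_int.1 ((hL 1).trans h1.symm)
  refine ⟨m - n, ?_⟩
  rw [hn, hm]; push_cast; ring

theorem k33_paths (a b : Fin 3 → ℂ) (γ : Fin 3 → Fin 3 → C(I, ℂ))
    (h0 : ∀ i j, γ i j 0 = a i) (h1 : ∀ i j, γ i j 1 = b j) :
    ∃ i k j l, i ≠ k ∧ j ≠ l ∧ ∃ s t, γ i j s = γ k l t := by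
  by_contra hcon
  push Not at hcon
  have hdis : ∀ i k j l, i ≠ k → j ≠ l → ∀ s t, γ i j s ≠ γ k l t := fun i k j l h h' => hcon i k j l h h'
  have other : ∀ j : Fin 3, ∃ l, j ≠ l := by decide
  have haa : ∀ i k, i ≠ k → a k - a i ≠ 0 := by
    intro i k h
    have := hdis k i 0 1 h.symm (by decide) 0 0
    rw [h0, h0] at this
    exact sub_ne_zero.2 this
  have hbb : ∀ i k, i ≠ k → b k - b i ≠ 0 := by
    intro i k h
    have := hdis 0 1 k i (by decide) h.symm 1 1
    rw [h1, h1] at this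
    exact sub_ne_zero.2 this
  have hab : ∀ i j, b j - a i ≠ 0 := by
    intro i j
    obtain ⟨k, hk⟩ := other i
    obtain ⟨l, hl⟩ := other j
    have := hdis k i j l hk.symm hl 1 0
    rw [h1, h0] at this
    exact sub_ne_zero.2 this
  let la : Fin 3 → Fin 3 → ℂ := fun i k => if i < k then Complex.log (a k - a i)
    else Complex.log (a i - a k) - Real.pi * Complex.I
  let lb : Fin 3 → Fin 3 → ℂ := fun i k => if i < k then Complex.log (b k - b i)
    else Complex.log (b i - b k) - Real.pi * Complex.I
  let lab : Fin 3 → Fin 3 → ℂ := fun i j => Complex.log (b j - a i)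
  have ela : ∀ i k, i ≠ k → Complex.exp (la i k) = a k - a i := by
    intro i k h
    simp only [la]
    split_ifs
    · exact Complex.exp_log (haa i k h)
    · rw [Complex.exp_sub, Complex.exp_log (haa k i h.symm), Complex.exp_pi_mul_I]; ring
  have elb : ∀ i k, i ≠ k → Complex.exp (lb i k) = b k - b i := by
    intro i k h
    simp only [lb]
    split_ifs
    · exact Complex.exp_log (hbb i k h)
    · rw [Complex.exp_sub, Complex.exp_log (hbb k i h.symm), Complex.exp_pi_mul_I]; ring
  have expab : ∀ i j, Complex.exp (lab i j) = b j - a i := fun i j => Complex.exp_log (hab i j)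
  have elba : ∀ i j, Complex.exp (lab i j - Real.pi * Complex.I) = a i - b j := by
    intro i j
    rw [Complex.exp_sub, expab, Complex.exp_pi_mul_I]; ring
  have hn : ∀ i k l, ∃ n : ℤ, i ≠ k → inc (a i) (γ k l) = lab i l - la i k + n * (2 * Real.pi * Complex.I) := by
    intro i k l
    by_cases h : i = k
    · exact ⟨0, fun h' => absurd h h'⟩
    obtain ⟨j, hj⟩ := other l
    obtain ⟨n, hn⟩ := inc_int (a i) (γ k l) (fun t => by
      rw [← h0 i j]; exact hdis k i l j (Ne.symm h) hj t 0) (la i k) (lab i l)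
      (by rw [ela i k h, h0]) (by rw [expab, h1])
    exact ⟨n, fun _ => hn⟩
  have hm : ∀ j k l, ∃ n : ℤ, j ≠ l → inc (b j) (γ k l) =
      lb j l - (lab k j - Real.pi * Complex.I) + n * (2 * Real.pi * Complex.I) := by
    intro j k l
    by_cases h : j = l
    · exact ⟨0, fun h' => absurd h h'⟩
    obtain ⟨i, hi⟩ := other k
    obtain ⟨n, hn⟩ := inc_int (b j) (γ k l) (fun t => by
      rw [← h1 i j]; exact hdis k i l j hi (Ne.symm h) t 1) (lab k j - Real.pi * Complex.I) (lb j l)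
      (by rw [elba, h0]) (by rw [elb j l h, h1])
    exact ⟨n, fun _ => hn⟩
  choose n hn using hn
  choose m hm using hm
  have key : ∀ i k j l, i < k → j ≠ l →
      m l i j - n k i j - (if j < l then 1 else 0) = m j k l - n i k l := by
    intro i k j l hik hjl
    have hsq := square (γ i j) (γ k l) (hdis i k j l hik.ne hjl)
    rw [h1, h0, h1, h0, hm l i j hjl.symm, hn k i j hik.ne', hm j k l hjl, hn i k l hik.ne] at hsq
    have e1 : la k i = la i k - Real.pi * Complex.I := by
      simp [la, hik, hik.not_gt]
    have e2 : lb l j - lb j l = if j < l then - (Real.pi * Complex.I) else Real.pi * Complex.I := by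
      rcases lt_or_gt_of_ne hjl with h | h
      · simp [lb, h, h.not_gt]
      · simp [lb, h, h.not_gt]
    have hpi : (2 * Real.pi * Complex.I : ℂ) ≠ 0 := Complex.two_pi_I_ne_zero
    have : ((m l i j - n k i j - (if j < l then 1 else 0) - (m j k l - n i k l) : ℤ) : ℂ)
        * (2 * Real.pi * Complex.I) = 0 := by
      push_cast
      rw [e1] at hsq
      split_ifs with h
      · rw [if_pos h] at e2
        linear_combination hsq - e2
      · rw [if_neg h] at e2
        linear_combination hsq - e2
    rcases mul_eq_zero.1 this with h | h
    · have := Int.cast_eq_zero.1 h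
      omega
    · exact absurd h hpi
  have k0 := key 0 1 0 1 (by decide) (by decide)
  have k1 := key 0 1 0 2 (by decide) (by decide)
  have k2 := key 0 1 1 0 (by decide) (by decide)
  have k3 := key 0 1 1 2 (by decide) (by decide)
  have k4 := key 0 1 2 0 (by decide) (by decide)
  have k5 := key 0 1 2 1 (by decide) (by decide)
  have k6 := key 0 2 0 1 (by decide) (by decide)
  have k7 := key 0 2 0 2 (by decide) (by decide)
  have k8 := key 0 2 1 0 (by decide) (by decide)
  have k9 := key 0 2 1 2 (by decide) (by decide)
  have k10 := key 0 2 2 0 (by decide) (by decide)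
  have k11 := key 0 2 2 1 (by decide) (by decide)
  have k12 := key 1 2 0 1 (by decide) (by decide)
  have k13 := key 1 2 0 2 (by decide) (by decide)
  have k14 := key 1 2 1 0 (by decide) (by decide)
  have k15 := key 1 2 1 2 (by decide) (by decide)
  have k16 := key 1 2 2 0 (by decide) (by decide)
  have k17 := key 1 2 2 1 (by decide) (by decide)
  clear key hn hm hdis hcon
  simp (decide := true) only [if_true, if_false] at *
  omega

theorem k33_joined (a b : Fin 3 → ℝ × ℝ) (S : Fin 3 → Fin 3 → Set (ℝ × ℝ))
    (h : ∀ i j, JoinedIn (S i j) (a i) (b j)) :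
    ∃ i k j l, i ≠ k ∧ j ≠ l ∧ (S i j ∩ S k l).Nonempty := by
  let φ : ℝ × ℝ ≃ ℂ := Complex.equivRealProd.symm
  have hφ : Continuous φ := Complex.equivRealProdCLM.symm.continuous
  obtain ⟨i, k, j, l, hik, hjl, s, t, hst⟩ := k33_paths (fun i => φ (a i)) (fun i => φ (b i))
    (fun i j => ⟨fun t => φ ((h i j).somePath t), by fun_prop⟩) (by simp) (by simp)
  refine ⟨i, k, j, l, hik, hjl, (h i j).somePath s, (h i j).somePath_mem s, ?_⟩
  have := φ.injective hst
  rw [this]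
  exact (h k l).somePath_mem t

end K33


namespace KPR

variable {X : Type}

/-- `JI H S x y`: there is an `H`-walk from `x` to `y` all of whose nodes lie in `S`. -/
inductive JI (H : SimpleGraph X) (S : Set X) : X → X → Prop
  | refl (x : X) : x ∈ S → JI H S x x
  | step (x y z : X) : JI H S x y → H.Adj y z → z ∈ S → JI H S x z

namespace JI

variable {H H' : SimpleGraph X} {S T : Set X} {x y z : X}

lemma left (h : JI H S x y) : x ∈ S := by induction h <;> assumption

lemma right (h : JI H S x y) : y ∈ S := by cases h <;> assumption

lemma mono (h : JI H S x y) (hH : H ≤ H') (hS : S ⊆ T) : JI H' T x y := by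
  induction h with
  | refl hx => exact .refl x (hS hx)
  | step y z _ a b ih => exact .step x y z ih (hH a) (hS b)

lemma trans (h : JI H S x y) (h' : JI H S y z) : JI H S x z := by
  induction h' with
  | refl hx => exact h
  | step y z _ a b ih => exact .step x y z ih a b

lemma adj (h : H.Adj x y) (hx : x ∈ S) (hy : y ∈ S) : JI H S x y :=
  .step x x y (.refl x hx) h hy

lemma symm (h : JI H S x y) : JI H S y x := by
  induction h with
  | refl hx => exact .refl x hx
  | step y z h1 a b ih => exact (adj a.symm b h1.right).trans ih

lemma strong (h : JI H S x y) : JI H {q | JI H S x q} x y := by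
  induction h with
  | refl hx => exact .refl x (.refl x hx)
  | step y z h1 a b ih => exact .step x y z ih a (JI.step x y z h1 a b)

lemma reach (h : JI H S x y) : H.Reachable x y := by
  induction h with
  | refl hx => exact .refl x
  | step y z h1 a b ih => exact ih.trans a.reachable

lemma of_reach (h : H.Reachable x y) : JI H {q | H.Reachable x q} x y := by
  obtain ⟨p⟩ := h
  induction p with
  | nil => exact .refl _ (SimpleGraph.Reachable.refl _)
  | cons a p ih =>
    exact (adj a (SimpleGraph.Reachable.refl _) a.reachable).trans
      (ih.mono le_rfl fun q hq => a.reachable.trans hq)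

lemma upgrade (h : JI H S x y) (hH : ∀ p ∈ S, ∀ q ∈ S, H.Adj p q → H'.Adj p q) : JI H' S x y := by
  induction h with
  | refl hx => exact .refl x hx
  | step y z h1 a b ih => exact .step x y z ih (hH _ h1.right _ b a) b

lemma split (Z : Set X) (h : JI H S x y) (hx : x ∉ Z) :
    JI H (S \ Z) x y ∨ ∃ w z, JI H (S \ Z) x w ∧ H.Adj w z ∧ z ∈ S ∧ z ∈ Z := by
  induction h with
  | refl hx' => exact .inl (.refl x ⟨hx', hx⟩)
  | step y z h1 a b ih =>
    rcases ih with h | h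
    · by_cases hz : z ∈ Z
      · exact .inr ⟨y, z, h, a, b, hz⟩
      · exact .inl (.step x y z h a ⟨b, hz⟩)
    · exact .inr h

end JI

variable {E : Type}

/-- `Conn R ω H x y n`: `x` can be joined to `y` by a chain of string pieces of total cost `n`. -/
inductive Conn (R : E → Set X) (ω : E → ℕ) (H : SimpleGraph X) : X → X → ℕ → Prop
  | refl (x : X) : Conn R ω H x x 0
  | step (x y z : X) (n : ℕ) (e : E) : Conn R ω H x y n → JI H (R e) y z → Conn R ω H x z (n + ω e)

def Near (R : E → Set X) (ω : E → ℕ) (H : SimpleGraph X) (x y : X) (B : ℕ) : Prop :=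
  ∃ n ≤ B, Conn R ω H x y n

namespace Conn

variable {R : E → Set X} {ω : E → ℕ} {H H' : SimpleGraph X} {x y z : X} {m n : ℕ}

lemma one {e : E} (h : JI H (R e) x y) : Conn R ω H x y (ω e) := by
  have := Conn.step (ω := ω) x x y 0 e (.refl x) h
  rwa [zero_add] at this

lemma trans (h : Conn R ω H x y m) (h' : Conn R ω H y z n) : Conn R ω H x z (m + n) := by
  induction h' with
  | refl => exact h
  | step z w n e _ j ih => rw [← add_assoc]; exact .step x z w _ e ih j

lemma symm (h : Conn R ω H x y n) : Conn R ω H y x n := by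
  induction h with
  | refl => exact .refl _
  | step z w n e _ j ih => rw [add_comm]; exact (one j.symm).trans ih

lemma mono (h : Conn R ω H x y n) (hH : H ≤ H') : Conn R ω H' x y n := by
  induction h with
  | refl => exact .refl _
  | step z w n e _ j ih => exact .step _ _ _ _ _ ih (j.mono hH subset_rfl)

lemma reach (h : Conn R ω H x y n) : H.Reachable x y := by
  induction h with
  | refl => exact .refl _
  | step z w n e _ j ih => exact ih.trans j.reach

lemma of_reach (h2 : ∀ p q, H.Adj p q → ∃ e, p ∈ R e ∧ q ∈ R e) (h : H.Reachable x y) :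
    ∃ n, Conn R ω H x y n := by
  obtain ⟨p⟩ := h
  induction p with
  | nil => exact ⟨0, .refl _⟩
  | cons a p ih =>
    obtain ⟨n, hn⟩ := ih
    obtain ⟨e, he1, he2⟩ := h2 _ _ a
    exact ⟨_, (one (JI.adj a he1 he2)).trans hn⟩

lemma joined (h : Conn R ω H x y n) : JI H {q | Near R ω H x q n} x y := by
  induction h with
  | refl => exact .refl _ ⟨0, le_rfl, .refl _⟩
  | step y z n e h j ih =>
    refine (ih.mono le_rfl ?_).trans (j.strong.mono le_rfl ?_)
    · rintro q ⟨m, hm, hq⟩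
      exact ⟨m, by omega, hq⟩
    · intro q hq
      exact ⟨_, le_rfl, .step _ _ _ _ _ h hq⟩

end Conn

namespace Near
variable {R : E → Set X} {ω : E → ℕ} {H H' : SimpleGraph X} {x y z : X} {m n : ℕ}

lemma trans (h : Near R ω H x y m) (h' : Near R ω H y z n) : Near R ω H x z (m + n) := by
  obtain ⟨a, ha, h⟩ := h
  obtain ⟨b, hb, h'⟩ := h'
  exact ⟨a + b, by omega, h.trans h'⟩

lemma symm (h : Near R ω H x y m) : Near R ω H y x m := by
  obtain ⟨a, ha, h⟩ := h
  exact ⟨a, ha, h.symm⟩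

lemma mono (h : Near R ω H x y m) (hH : H ≤ H') (hm : m ≤ n) : Near R ω H' x y n := by
  obtain ⟨a, ha, h⟩ := h
  exact ⟨a, ha.trans hm, h.mono hH⟩

lemma reach (h : Near R ω H x y m) : H.Reachable x y := by
  obtain ⟨a, ha, h⟩ := h
  exact h.reach

end Near

/-- A level function: distance from the root of each component. -/
structure Lev (R : E → Set X) (ω : E → ℕ) (H : SimpleGraph X) (root : X → X) (l : X → ℕ) : Prop where
  conn : ∀ p, Conn R ω H (root p) p (l p)
  le : ∀ p n, Conn R ω H (root p) p n → l p ≤ n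
  root_eq : ∀ p q, H.Reachable p q → root p = root q

lemma exists_lev (R : E → Set X) (ω : E → ℕ) (H : SimpleGraph X)
    (h2 : ∀ p q, H.Adj p q → ∃ e, p ∈ R e ∧ q ∈ R e) : ∃ root l, Lev R ω H root l := by
  classical
  let root : X → X := fun p => (H.connectedComponentMk p).out
  have hr : ∀ p, H.Reachable (root p) p := fun p =>
    SimpleGraph.ConnectedComponent.exact (Quot.out_eq (H.connectedComponentMk p))
  have hex : ∀ p, ∃ n, Conn R ω H (root p) p n := fun p => Conn.of_reach h2 (hr p)
  refine ⟨root, fun p => Nat.find (hex p), fun p => Nat.find_spec (hex p),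
    fun p n hn => Nat.find_min' (hex p) hn, fun p q h => ?_⟩
  simp only [root]
  rw [SimpleGraph.ConnectedComponent.sound h]

namespace Lev

variable {R : E → Set X} {ω : E → ℕ} {H H' : SimpleGraph X} {root : X → X} {l : X → ℕ}
  {p q : X} {n : ℕ}

lemma lip (L : Lev R ω H root l) (h : Near R ω H p q n) : l q ≤ l p + n := by
  obtain ⟨m, hm, h⟩ := h
  have := L.le q (l p + m) (by rw [← L.root_eq p q h.reach]; exact (L.conn p).trans h)
  omega

lemma to_root (L : Lev R ω H root l) (z : X) :
    JI H {q | l q ≤ l z ∧ H.Reachable z q} z (root z) := by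
  refine ((L.conn z).joined.mono le_rfl ?_).symm
  intro q hq
  have hz := (L.conn z).reach
  obtain ⟨m, hm, hq⟩ := hq
  have hr := L.root_eq (root z) q hq.reach
  have hr' := L.root_eq (root z) z hz
  refine ⟨(L.le q m ?_).trans hm, hz.symm.trans hq.reach⟩
  rw [← hr, hr']; exact hq

lemma last (L : Lev R ω H root l) (v : X) (hv : 0 < l v) :
    ∃ e u, JI H (R e) u v ∧ l u + ω e ≤ l v := by
  have h := L.conn v
  generalize hn : l v = n at h
  generalize hx : root v = x at h
  cases h with
  | refl => omega
  | step y _ m e h j =>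
    refine ⟨e, y, j, ?_⟩
    have : l y ≤ m := L.le y m (by rw [L.root_eq y v j.reach, hx]; exact h)
    omega

lemma tail (L : Lev R ω H root l) {τ lam B : ℕ} (hω : ∀ e, 1 ≤ ω e) (hωτ : ∀ e, ω e ≤ τ)
    (hH : ∀ p q, H.Adj p q → lam < l p → l p ≤ B → lam < l q → l q ≤ B → H'.Adj p q) :
    ∀ v, lam < l v → l v ≤ B → ∃ z, l z ≤ lam ∧ lam ≤ l z + τ ∧
      (∃ n, n + lam ≤ l v + τ ∧ Conn R ω H v z n) ∧
      JI H ({q | lam < l q ∧ l q ≤ l v ∧ ∃ n, n + lam ≤ l v + τ ∧ Conn R ω H' v q n} ∪ {z}) v z := by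
  intro v
  induction hk : l v using Nat.strong_induction_on generalizing v with
  | _ k ih =>
  subst hk
  intro hlv hvB
  obtain ⟨e, u, hj, hle⟩ := L.last v (by omega)
  have hωe := hω e
  have hωe' := hωτ e
  have hlev : ∀ q, JI H (R e) u q → l q ≤ l v := fun q hq =>
    (L.lip ⟨_, le_rfl, Conn.one hq⟩).trans hle
  have hj' := hj.strong.symm
  have hup : ∀ q, JI H ({q | JI H (R e) u q} \ {q | l q ≤ lam}) v q →
      JI H' {q | lam < l q ∧ l q ≤ l v ∧ ∃ n, n ≤ ω e ∧ Conn R ω H' v q n} v q := by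
    intro q hq
    have hq' := hq.upgrade (H' := H') (fun p hp q hq hpq => by
      refine hH p q hpq ?_ ?_ ?_ ?_
      · simpa using hp.2
      · exact (hlev _ hp.1).trans hvB
      · simpa using hq.2
      · exact (hlev _ hq.1).trans hvB)
    refine hq'.strong.mono le_rfl ?_
    intro r hr
    refine ⟨by simpa using hr.right.2, hlev _ hr.right.1, _, le_rfl, Conn.one (hr.mono le_rfl ?_)⟩
    intro s hs
    exact hs.1.right
  have hup' : ∀ q, JI H ({q | JI H (R e) u q} \ {q | l q ≤ lam}) v q →
      JI H {q | lam < l q ∧ l q ≤ l v ∧ ∃ n, n ≤ ω e ∧ Conn R ω H' v q n} v q := by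
    intro q hq
    refine hq.strong.mono le_rfl ?_
    intro r hr
    exact (hup r hr).right
  rcases hj'.split {q | l q ≤ lam} (by simpa using hlv) with hs | ⟨w, z, hs, hwz, hz, hzl⟩
  · have hu : lam < l u := (hup u hs).right.1
    obtain ⟨z, hz1, hz2, ⟨n, hn, hzn⟩, hz3⟩ := ih (l u) (by omega) u rfl hu (by omega)
    refine ⟨z, hz1, hz2, ⟨ω e + n, by omega, (Conn.one hj.symm).trans hzn⟩, ?_⟩
    obtain ⟨m, hm, hvu⟩ := (hup u hs).right.2.2
    refine ((hup' u hs).mono le_rfl ?_).trans (hz3.mono le_rfl ?_)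
    · rintro q ⟨h1, h2, n, hn, hc⟩
      exact .inl ⟨h1, h2, n, by omega, hc⟩
    · rintro q (⟨h1, h2, n', hn', hc⟩ | hq)
      · exact .inl ⟨h1, by omega, m + n', by omega, hvu.trans hc⟩
      · exact .inr hq
  · have hzR : z ∈ R e := hz.right
    have hw := hs.right
    have hwl : lam < l w := by simpa using hw.2
    have hwz' : l w ≤ l z + ω e := L.lip ⟨_, le_rfl, Conn.one (JI.adj hwz.symm hzR hw.1.right)⟩
    refine ⟨z, hzl, by omega, ⟨ω e, by omega, Conn.one (hj.symm.trans hz)⟩, ?_⟩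
    refine .step _ w _ ((hup' w hs).mono le_rfl ?_) hwz (.inr rfl)
    rintro q ⟨h1, h2, n, hn, hc⟩
    exact .inl ⟨h1, h2, n, by omega, hc⟩

end Lev

/-- keep only edges along which `f` is constant -/
def chop (H : SimpleGraph X) (f : X → ℕ) : SimpleGraph X where
  Adj p q := H.Adj p q ∧ f p = f q
  symm := ⟨fun _ _ h => ⟨h.1.symm, h.2.symm⟩⟩
  loopless := ⟨fun _ h => H.loopless.irrefl _ h.1⟩

lemma chop_le (H : SimpleGraph X) (f : X → ℕ) : chop H f ≤ H := fun _ _ h => h.1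

lemma chop_reach {H : SimpleGraph X} {f : X → ℕ} {p q : X} (h : (chop H f).Reachable p q) :
    f p = f q := by
  obtain ⟨w⟩ := h
  induction w with
  | nil => rfl
  | cons a w ih => exact a.2.trans ih

lemma hermite (τ : ℕ) (hτ : 0 < τ) (a : ℕ) : ∑ θ ∈ Finset.range τ, (a + θ) / τ = a := by
  induction a with
  | zero =>
    refine Finset.sum_eq_zero fun θ hθ => ?_
    rw [zero_add]
    exact Nat.div_eq_of_lt (Finset.mem_range.1 hθ)
  | succ a ih =>
    have h1 := Finset.sum_range_succ (fun θ => (a + θ) / τ) τ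
    have h2 := Finset.sum_range_succ' (fun θ => (a + θ) / τ) τ
    rw [h1, ih] at h2
    simp only [add_zero, Nat.add_div_right a hτ] at h2
    have : ∑ θ ∈ Finset.range τ, (a + 1 + θ) / τ = ∑ k ∈ Finset.range τ, (a + (k + 1)) / τ :=
      Finset.sum_congr rfl fun k _ => by congr 1; omega
    rw [this]; omega

open Classical in
lemma exists_theta [Fintype E] (R : E → Set X) (ω : E → ℕ) (H : SimpleGraph X) (l : X → ℕ) (τ : ℕ)
    (hτ : 0 < τ) (hl : ∀ e p q, JI H (R e) p q → l q ≤ l p + ω e) :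
    ∃ θ < τ, τ * (Finset.univ.filter fun e => (∀ p ∈ R e, ∀ q ∈ R e, JI H (R e) p q) ∧
      ¬ ∀ p ∈ R e, ∀ q ∈ R e, (l p + θ) / τ = (l q + θ) / τ).card ≤ ∑ e, ω e := by
  by_contra hcon
  simp only [not_exists, not_and, not_le] at hcon
  set bad : ℕ → E → Prop := fun θ e => (∀ p ∈ R e, ∀ q ∈ R e, JI H (R e) p q) ∧
      ¬ ∀ p ∈ R e, ∀ q ∈ R e, (l p + θ) / τ = (l q + θ) / τ with hbad
  have h1 : ∀ e, ∑ θ ∈ Finset.range τ, (if bad θ e then 1 else 0) ≤ ω e := by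
    intro e
    by_cases hc : (∀ p ∈ R e, ∀ q ∈ R e, JI H (R e) p q) ∧ (R e).Nonempty
    · obtain ⟨hc, hne⟩ := hc
      obtain ⟨r, hr, hrm⟩ : ∃ r ∈ R e, ∀ q ∈ R e, l r ≤ l q := by
        have hex : ∃ n, ∃ r ∈ R e, l r = n := ⟨_, _, hne.choose_spec, rfl⟩
        obtain ⟨r, hr, hrn⟩ := Nat.find_spec hex
        exact ⟨r, hr, fun q hq => hrn ▸ Nat.find_min' hex ⟨q, hq, rfl⟩⟩
      have h3 : ∑ θ ∈ Finset.range τ, ((if bad θ e then 1 else 0) + (l r + θ) / τ)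
          ≤ ∑ θ ∈ Finset.range τ, (l r + ω e + θ) / τ := by
        refine Finset.sum_le_sum fun θ _ => ?_
        have hmono : (l r + θ) / τ ≤ (l r + ω e + θ) / τ := Nat.div_le_div_right (by omega)
        split_ifs with hb
        · by_contra hlt
          apply hb.2
          have hall : ∀ p ∈ R e, (l p + θ) / τ = (l r + θ) / τ := by
            intro p hp
            have a1 : (l r + θ) / τ ≤ (l p + θ) / τ :=
              Nat.div_le_div_right (by have := hrm p hp; omega)
            have a2 : (l p + θ) / τ ≤ (l r + ω e + θ) / τ :=
              Nat.div_le_div_right (by have := hl e r p (hc r hr p hp); omega)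
            omega
          intro p hp q hq
          rw [hall p hp, hall q hq]
        · omega
      rw [Finset.sum_add_distrib, hermite τ hτ, hermite τ hτ] at h3
      omega
    · rw [Finset.sum_eq_zero]
      · omega
      · intro θ _
        rw [if_neg]
        rintro ⟨hb1, hb2⟩
        push Not at hb2
        obtain ⟨p, hp, -⟩ := hb2
        exact hc ⟨hb1, p, hp⟩
  have h2 : ∑ θ ∈ Finset.range τ, ∑ e, (if bad θ e then 1 else 0) ≤ ∑ e, ω e := by
    rw [Finset.sum_comm]
    exact Finset.sum_le_sum fun e _ => h1 e
  have h3 : ∀ θ ∈ Finset.range τ, (∑ e, ω e) + 1 ≤ τ * ∑ e, (if bad θ e then 1 else 0) := by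
    intro θ hθ
    have := hcon θ (Finset.mem_range.1 hθ)
    rw [Finset.card_filter] at this
    exact this
  have h4 := Finset.sum_le_sum h3
  rw [← Finset.mul_sum, Finset.sum_const, Finset.card_range, smul_eq_mul] at h4
  have := Nat.le_of_mul_le_mul_left h4 hτ
  omega

/-- the K33 property -/
def K33Free (Γ : SimpleGraph X) : Prop :=
  ∀ (a b : Fin 3 → X) (P : Fin 3 → Fin 3 → Set X), (∀ i j, JI Γ (P i j) (a i) (b j)) →
    ∃ i k j l, i ≠ k ∧ j ≠ l ∧ (P i j ∩ P k l).Nonempty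

lemma K33Free.mono {Γ Γ' : SimpleGraph X} (h : K33Free Γ) (hle : Γ' ≤ Γ) : K33Free Γ' :=
  fun a b P hP => h a b P fun i j => (hP i j).mono hle subset_rfl

end KPR


namespace KPR

variable {X E : Type}

lemma claim (R : E → Set X) (ω : E → ℕ) (Γ : SimpleGraph X) (h3 : K33Free Γ) (τ : ℕ) (hτ : 0 < τ)
    (hω : ∀ e, 1 ≤ ω e) (hωτ : ∀ e, ω e ≤ τ) (r0 r1 : X → X) (l0 l1 : X → ℕ) (θ0 θ1 : ℕ)
    (hθ0 : θ0 < τ)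
    (L0 : Lev R ω Γ r0 l0)
    (L1 : Lev R ω (chop Γ fun p => (l0 p + θ0) / τ) r1 l1)
    (v : Fin 3 → X) (hv : ∀ i j, (chop (chop Γ fun p => (l0 p + θ0) / τ)
      fun p => (l1 p + θ1) / τ).Reachable (v i) (v j)) :
    ∃ i j, i ≠ j ∧ Near R ω Γ (v i) (v j) (21 * τ) := by
  by_contra hfar
  push Not at hfar
  set Γ1 := chop Γ (fun p => (l0 p + θ0) / τ) with hΓ1
  set Γ2 := chop Γ1 (fun p => (l1 p + θ1) / τ) with hΓ2
  have le1 : Γ1 ≤ Γ := chop_le _ _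
  have le2 : Γ2 ≤ Γ1 := chop_le _ _
  have e01 : (0 : Fin 3) ≠ 1 := by decide
  set k := (l0 (v 0) + θ0) / τ with hk
  -- band at stage 0
  have band : ∀ q, Γ1.Reachable (v 0) q → k * τ ≤ l0 q + θ0 ∧ l0 q + θ0 < k * τ + τ := by
    intro q hq
    have : k = (l0 q + θ0) / τ := chop_reach hq
    rw [this]
    have a := Nat.div_mul_le_self (l0 q + θ0) τ
    have b := Nat.lt_div_mul_add (a := l0 q + θ0) hτ
    exact ⟨a, b⟩
  have v1 : ∀ i j, Γ1.Reachable (v i) (v j) := fun i j => (hv i j).mono le2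
  have farn : ∀ i j n, i ≠ j → n ≤ 21 * τ → ¬ Near R ω Γ1 (v i) (v j) n :=
    fun i j n hij hn h => hfar i j hij (h.mono le1 hn)
  -- the band does not contain the root
  have hkθ : θ0 < k * τ := by
    by_contra hle
    push Not at hle
    have near : ∀ i, Near R ω Γ (r0 (v 0)) (v i) τ := by
      intro i
      have hr := L0.root_eq _ _ ((v1 0 i).mono le1)
      have hc := L0.conn (v i)
      rw [← hr] at hc
      have := (band _ (v1 0 i)).2
      have hk0 : k = 0 := by
        by_contra hk0
        have : 1 * τ ≤ k * τ := Nat.mul_le_mul_right _ (Nat.one_le_iff_ne_zero.2 hk0)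
        omega
      rw [hk0] at this
      exact ⟨_, by omega, hc⟩
    exact hfar 0 1 e01 (((near 0).symm.trans (near 1)).mono le_rfl (by omega))
  -- cluster levels at stage 1
  have clus : ∀ q, Γ2.Reachable (v 0) q → l1 (v 0) < l1 q + τ ∧ l1 q < l1 (v 0) + τ := by
    intro q hq
    have : (l1 (v 0) + θ1) / τ = (l1 q + θ1) / τ := chop_reach hq
    have a := Nat.div_mul_le_self (l1 q + θ1) τ
    have b := Nat.lt_div_mul_add (a := l1 q + θ1) hτ
    have a' := Nat.div_mul_le_self (l1 (v 0) + θ1) τ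
    have b' := Nat.lt_div_mul_add (a := l1 (v 0) + θ1) hτ
    rw [this] at a' b'
    omega
  set s := l1 (v 0) with hs
  have hs9 : 9 * τ ≤ s := by
    by_contra hlt
    push Not at hlt
    have near : ∀ i, Near R ω Γ1 (r1 (v 0)) (v i) (10 * τ) := by
      intro i
      have hr := L1.root_eq _ _ (v1 0 i)
      have hc := L1.conn (v i)
      rw [← hr] at hc
      have := (clus _ (hv 0 i)).2
      exact ⟨_, by omega, hc⟩
    exact farn 0 1 _ e01 (by omega) ((near 0).symm.trans (near 1))
  obtain ⟨lam', hlam'⟩ : ∃ x, x + 5 * τ = s := ⟨s - 5 * τ, by omega⟩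
  obtain ⟨lam'', hlam''⟩ : ∃ x, x + 9 * τ = s := ⟨s - 9 * τ, by omega⟩
  obtain ⟨lam0, hlam0⟩ : ∃ x, x + θ0 + 1 = k * τ := ⟨k * τ - θ0 - 1, by omega⟩
  -- the tails W_j
  have tW : ∀ j, ∃ b, l1 b ≤ lam' ∧ lam' ≤ l1 b + τ ∧ Near R ω Γ1 (v j) b (7 * τ) ∧
      JI Γ1 ({q | lam' < l1 q ∧ Near R ω Γ1 (v j) q (7 * τ)} ∪ {b}) (v j) b := by
    intro j
    have hvj := clus _ (hv 0 j)
    obtain ⟨z, hz1, hz2, ⟨n, hn, hzn⟩, hz3⟩ := L1.tail (H' := Γ1) (τ := τ) (lam := lam')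
      (B := l1 (v j)) hω hωτ
      (fun p q h _ _ _ _ => h) (v j) (by omega) le_rfl
    refine ⟨z, hz1, hz2, ⟨n, by omega, hzn⟩, hz3.mono le_rfl ?_⟩
    rintro q (⟨h1, h2, m, hm, hc⟩ | hq)
    · exact .inl ⟨h1, m, by omega, hc⟩
    · exact .inr hq
  choose b hb1 hb2 hb3 hb4 using tW
  have rb : ∀ j, Γ1.Reachable (v 0) (b j) := fun j => (v1 0 j).trans (hb3 j).reach
  -- paths to root_1
  have t1 : ∀ j, JI Γ1 {q | Γ1.Reachable (v 0) q ∧ (l1 q ≤ lam'' ∨ (l1 q ≤ lam' ∧ Near R ω Γ1 (b j) q (5 * τ)))}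
      (b j) (r1 (v 0)) := by
    intro j
    have q1 := hb1 j
    have q2 := hb2 j
    obtain ⟨z, hz1, hz2, ⟨n, hn, hzn⟩, hz3⟩ := L1.tail (H' := Γ1) (τ := τ) (lam := lam'')
      (B := l1 (b j)) hω hωτ
      (fun p q h _ _ _ _ => h) (b j) (by omega) le_rfl
    have rz : Γ1.Reachable (v 0) z := (rb j).trans hzn.reach
    have hr := L1.root_eq _ _ rz
    refine (hz3.mono le_rfl ?_).trans ((hr ▸ L1.to_root z).mono le_rfl ?_)
    · rintro q (⟨h1, h2, m, hm, hc⟩ | hq)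
      · exact ⟨(rb j).trans hc.reach, .inr ⟨by omega, m, by omega, hc⟩⟩
      · obtain rfl : q = z := hq
        exact ⟨rz, .inl hz1⟩
    · rintro q ⟨hq1, hq2⟩
      exact ⟨rz.trans hq2, .inl (hq1.trans hz1)⟩
  -- paths to root_0
  have t0 : ∀ j, JI Γ {q | l0 q ≤ lam0 ∨ Near R ω Γ1 (b j) q (2 * τ)} (b j) (r0 (v 0)) := by
    intro j
    have bj := band _ (rb j)
    obtain ⟨z, hz1, hz2, ⟨n, hn, hzn⟩, hz3⟩ := L0.tail (H' := Γ1) (τ := τ) (lam := lam0)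
      (B := l0 (b j)) hω hωτ
      (fun p q h p1 p2 q1 q2 => by
        refine ⟨h, ?_⟩
        have hp : (l0 p + θ0) / τ = k := by
          rw [Nat.div_eq_iff hτ]; omega
        have hq : (l0 q + θ0) / τ = k := by
          rw [Nat.div_eq_iff hτ]; omega
        simp only [hp, hq]) (b j) (by omega) le_rfl
    have rz : Γ.Reachable (v 0) z := ((rb j).mono le1).trans hzn.reach
    have hr := L0.root_eq _ _ rz
    refine (hz3.mono le_rfl ?_).trans ((hr ▸ L0.to_root z).mono le_rfl ?_)
    · rintro q (⟨h1, h2, m, hm, hc⟩ | hq)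
      · exact .inr ⟨m, by omega, hc⟩
      · obtain rfl : q = z := hq
        exact .inl hz1
    · rintro q ⟨hq1, hq2⟩
      exact .inl (hq1.trans hz1)
  -- paths from the cluster
  have t2 : ∀ j, JI Γ {q | Γ1.Reachable (v 0) q ∧ (s < l1 q + τ ∨
      (lam' < l1 q ∧ Near R ω Γ1 (v j) q (7 * τ)) ∨ q = b j)} (b j) (v 0) := by
    intro j
    refine JI.symm (((JI.of_reach (hv 0 j)).mono (le2.trans le1) ?_).trans ((hb4 j).strong.mono le1 ?_))
    · intro q hq
      exact ⟨hq.mono le2, .inl (clus q hq).1⟩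
    · intro q hq
      refine ⟨(v1 0 j).trans hq.reach, .inr ?_⟩
      rcases hq.right with h | h
      · exact .inl h
      · exact .inr h
  obtain ⟨i, i', j, l, hii, hjl, hne⟩ := h3 ![r0 (v 0), r1 (v 0), v 0] b
    (fun i j => (![{q | l0 q ≤ lam0 ∨ Near R ω Γ1 (b j) q (2 * τ)},
      {q | Γ1.Reachable (v 0) q ∧ (l1 q ≤ lam'' ∨ (l1 q ≤ lam' ∧ Near R ω Γ1 (b j) q (5 * τ)))},
      {q | Γ1.Reachable (v 0) q ∧ (s < l1 q + τ ∨
      (lam' < l1 q ∧ Near R ω Γ1 (v j) q (7 * τ)) ∨ q = b j)}] : Fin 3 → Set X) i) (by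
    intro i j
    fin_cases i
    · exact (t0 j).symm
    · exact ((t1 j).mono le1 subset_rfl).symm
    · exact (t2 j).symm)
  -- disjointness facts
  have d01 : ∀ j l, j ≠ l → ∀ q, (l0 q ≤ lam0 ∨ Near R ω Γ1 (b j) q (2 * τ)) →
      (Γ1.Reachable (v 0) q ∧ (l1 q ≤ lam'' ∨ (l1 q ≤ lam' ∧ Near R ω Γ1 (b l) q (5 * τ)))) → False := by
    rintro j l hjl q hq ⟨hr, hq'⟩
    have := band q hr
    rcases hq with hq | hq
    · omega
    have h1 := L1.lip hq.symm
    have h2 := hb2 j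
    rcases hq' with hq' | ⟨-, hq'⟩
    · omega
    exact farn j l _ hjl (by omega) (((hb3 j).trans hq).trans (hq'.symm.trans (hb3 l).symm))
  have d02 : ∀ j l, j ≠ l → ∀ q, (l0 q ≤ lam0 ∨ Near R ω Γ1 (b j) q (2 * τ)) →
      (Γ1.Reachable (v 0) q ∧ (s < l1 q + τ ∨
      (lam' < l1 q ∧ Near R ω Γ1 (v l) q (7 * τ)) ∨ q = b l)) → False := by
    rintro j l hjl q hq ⟨hr, hq'⟩
    have := band q hr
    rcases hq with hq | hq
    · omega
    have h1 := L1.lip hq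
    have h2 := hb1 j
    have hvq := (hb3 j).trans hq
    rcases hq' with hq' | ⟨-, hq'⟩ | rfl
    · omega
    · exact farn j l _ hjl (by omega) (hvq.trans hq'.symm)
    · exact farn j l _ hjl (by omega) (hvq.trans (hb3 l).symm)
  have d12 : ∀ j l, j ≠ l → ∀ q, (Γ1.Reachable (v 0) q ∧ (l1 q ≤ lam'' ∨
      (l1 q ≤ lam' ∧ Near R ω Γ1 (b j) q (5 * τ)))) →
      (Γ1.Reachable (v 0) q ∧ (s < l1 q + τ ∨
      (lam' < l1 q ∧ Near R ω Γ1 (v l) q (7 * τ)) ∨ q = b l)) → False := by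
    rintro j l hjl q ⟨-, hq⟩ ⟨hr, hq'⟩
    have h2 := hb1 l
    have h3 := hb2 l
    rcases hq' with hq' | ⟨hq1, hq'⟩ | rfl
    · omega
    · omega
    · rcases hq with hq | ⟨-, hq⟩
      · omega
      · exact farn j l _ hjl (by omega) (((hb3 j).trans hq).trans (hb3 l).symm)
  obtain ⟨q, hq1, hq2⟩ := hne
  fin_cases i <;> fin_cases i' <;>
    simp only [Fin.zero_eta, Fin.mk_one, Fin.reduceFinMk, Matrix.cons_val_zero, Matrix.cons_val_one,
      Matrix.cons_val, Set.mem_ofPred_eq, ne_eq, not_true_eq_false] at hii hq1 hq2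
  · exact d01 j l hjl q hq1 hq2
  · exact d02 j l hjl q hq1 hq2
  · exact d01 l j hjl.symm q hq2 hq1
  · exact d12 j l hjl q hq1 hq2
  · exact d02 l j hjl.symm q hq2 hq1
  · exact d12 l j hjl.symm q hq2 hq1

open Classical in
lemma chop_light [Fintype E] (R : E → Set X) (ω : E → ℕ) (Γ : SimpleGraph X) (h3 : K33Free Γ)
    (h1 : ∀ e, ∀ p ∈ R e, ∀ q ∈ R e, JI Γ (R e) p q)
    (h2 : ∀ p q, Γ.Adj p q → ∃ e, p ∈ R e ∧ q ∈ R e) (τ : ℕ) (hτ : 0 < τ)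
    (hω : ∀ e, 1 ≤ ω e) (hωτ : ∀ e, ω e ≤ τ) :
    ∃ H : SimpleGraph X, H ≤ Γ ∧
      τ * (Finset.univ.filter fun e => ¬ ∀ p ∈ R e, ∀ q ∈ R e, H.Reachable p q).card ≤ 2 * ∑ e, ω e ∧
      ∀ v : Fin 3 → X, (∀ i j, H.Reachable (v i) (v j)) →
        ∃ i j, i ≠ j ∧ Near R ω Γ (v i) (v j) (21 * τ) := by
  obtain ⟨r0, l0, L0⟩ := exists_lev R ω Γ h2
  obtain ⟨θ0, hθ0, hc0⟩ := exists_theta R ω Γ l0 τ hτ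
    (fun e p q h => L0.lip ⟨_, le_rfl, Conn.one h⟩)
  obtain ⟨r1, l1, L1⟩ := exists_lev R ω (chop Γ fun p => (l0 p + θ0) / τ)
    (fun p q h => h2 p q h.1)
  obtain ⟨θ1, hθ1, hc1⟩ := exists_theta R ω (chop Γ fun p => (l0 p + θ0) / τ) l1 τ hτ
    (fun e p q h => L1.lip ⟨_, le_rfl, Conn.one h⟩)
  refine ⟨chop (chop Γ fun p => (l0 p + θ0) / τ) fun p => (l1 p + θ1) / τ,
    (chop_le _ _).trans (chop_le _ _), ?_, fun v hv =>
    claim R ω Γ h3 τ hτ hω hωτ r0 r1 l0 l1 θ0 θ1 hθ0 L0 L1 v hv⟩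
  have hJ : ∀ (H : SimpleGraph X) (f : X → ℕ) (e : E), (∀ p ∈ R e, ∀ q ∈ R e, JI H (R e) p q) →
      (∀ p ∈ R e, ∀ q ∈ R e, f p = f q) → ∀ p ∈ R e, ∀ q ∈ R e, JI (chop H f) (R e) p q := by
    intro H f e hH hf p hp q hq
    exact (hH p hp q hq).upgrade fun a ha b hb hab => ⟨hab, hf a ha b hb⟩
  have hsub : (Finset.univ.filter fun e => ¬ ∀ p ∈ R e, ∀ q ∈ R e,
      (chop (chop Γ fun p => (l0 p + θ0) / τ) fun p => (l1 p + θ1) / τ).Reachable p q) ⊆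
      (Finset.univ.filter fun e => (∀ p ∈ R e, ∀ q ∈ R e, JI Γ (R e) p q) ∧
      ¬ ∀ p ∈ R e, ∀ q ∈ R e, (l0 p + θ0) / τ = (l0 q + θ0) / τ) ∪
      (Finset.univ.filter fun e => (∀ p ∈ R e, ∀ q ∈ R e,
        JI (chop Γ fun p => (l0 p + θ0) / τ) (R e) p q) ∧
      ¬ ∀ p ∈ R e, ∀ q ∈ R e, (l1 p + θ1) / τ = (l1 q + θ1) / τ) := by
    intro e he
    simp only [Finset.mem_filter, Finset.mem_univ, true_and, Finset.mem_union] at he ⊢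
    by_contra hcon
    rw [not_or] at hcon
    apply he
    have c0 : ∀ p ∈ R e, ∀ q ∈ R e, (l0 p + θ0) / τ = (l0 q + θ0) / τ := by
      by_contra hc
      exact hcon.1 ⟨h1 e, hc⟩
    have j1 := hJ Γ (fun p => (l0 p + θ0) / τ) e (h1 e) c0
    have c1 : ∀ p ∈ R e, ∀ q ∈ R e, (l1 p + θ1) / τ = (l1 q + θ1) / τ := by
      by_contra hc
      exact hcon.2 ⟨j1, hc⟩
    intro p hp q hq
    exact (hJ _ (fun p => (l1 p + θ1) / τ) e j1 c1 p hp q hq).reach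
  have := (Finset.card_le_card hsub).trans (Finset.card_union_le _ _)
  have := Nat.mul_le_mul_left τ this
  rw [Nat.mul_add] at this
  omega

open Classical in
/-- The chopping theorem for arbitrary weights. -/
theorem chop_thm [Fintype E] (R : E → Set X) (ω : E → ℕ) (Γ : SimpleGraph X) (h3 : K33Free Γ)
    (h1 : ∀ e, ∀ p ∈ R e, ∀ q ∈ R e, JI Γ (R e) p q) (τ : ℕ) (hτ : 0 < τ)
    (hω : ∀ e, 1 ≤ ω e) :
    ∃ H : SimpleGraph X, 
      τ * (Finset.univ.filter fun e => ¬ ∀ p ∈ R e, ∀ q ∈ R e, H.Reachable p q).card ≤ 3 * ∑ e, ω e ∧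
      ∀ v : Fin 3 → X, (∀ i j, H.Reachable (v i) (v j)) →
        ∃ i j, i ≠ j ∧ Near R ω Γ (v i) (v j) (21 * τ) := by
  let Γ' : SimpleGraph X :=
    { Adj := fun p q => Γ.Adj p q ∧ ∃ e, ω e ≤ τ ∧ p ∈ R e ∧ q ∈ R e
      symm := ⟨fun p q h => ⟨h.1.symm, h.2.choose, h.2.choose_spec.1, h.2.choose_spec.2.2,
        h.2.choose_spec.2.1⟩⟩
      loopless := ⟨fun p h => Γ.loopless.irrefl p h.1⟩ }
  have hle : Γ' ≤ Γ := fun p q h => h.1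
  obtain ⟨H, hH, hcut, hv⟩ := chop_light (E := {e : E // ω e ≤ τ}) (fun e => R e) (fun e => ω e) Γ'
    (h3.mono hle)
    (fun e p hp q hq => (h1 e p hp q hq).upgrade fun a ha b hb hab => ⟨hab, e, e.2, ha, hb⟩)
    (fun p q h => by
      obtain ⟨-, e, he, hp, hq⟩ := h
      exact ⟨⟨e, he⟩, hp, hq⟩) τ hτ (fun e => hω e) (fun e => e.2)
  refine ⟨H, ?_, ?_⟩
  · have hsub : (Finset.univ.filter fun e => ¬ ∀ p ∈ R e, ∀ q ∈ R e, H.Reachable p q) ⊆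
        ((Finset.univ.filter fun e : {e : E // ω e ≤ τ} =>
          ¬ ∀ p ∈ R e, ∀ q ∈ R e, H.Reachable p q).image Subtype.val) ∪
        (Finset.univ.filter fun e => τ < ω e) := by
      intro e he
      simp only [Finset.mem_filter, Finset.mem_univ, true_and, Finset.mem_union, Finset.mem_image] at he ⊢
      rcases le_or_gt (ω e) τ with h | h
      · exact .inl ⟨⟨e, h⟩, he, rfl⟩
      · exact .inr h
    have c1 := (Finset.card_le_card hsub).trans (Finset.card_union_le _ _)
    have c2 := Finset.card_image_le (s := (Finset.univ.filter fun e : {e : E // ω e ≤ τ} =>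
          ¬ ∀ p ∈ R e, ∀ q ∈ R e, H.Reachable p q)) (f := Subtype.val)
    have c3 : ∑ e : {e : E // ω e ≤ τ}, ω e ≤ ∑ e, ω e := by
      rw [← Finset.sum_subtype (Finset.univ.filter fun e => ω e ≤ τ) (by simp) ω]
      exact Finset.sum_le_sum_of_subset (Finset.filter_subset _ _)
    have c4 : τ * (Finset.univ.filter fun e => τ < ω e).card ≤ ∑ e, ω e := by
      rw [Nat.mul_comm, ← smul_eq_mul]
      refine le_trans (Finset.card_nsmul_le_sum _ ω τ ?_) (Finset.sum_le_sum_of_subset (Finset.filter_subset _ _))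
      intro e he
      exact (Finset.mem_filter.1 he).2.le
    have c5 := Nat.mul_le_mul_left τ (c1.trans (Nat.add_le_add_right c2 _))
    rw [Nat.mul_add] at c5
    omega
  · intro v hv'
    obtain ⟨i, j, hij, n, hn, hc⟩ := hv v hv'
    refine ⟨i, j, hij, n, hn, ?_⟩
    clear hn hv hv'
    generalize v i = x at hc ⊢
    generalize v j = y at hc ⊢
    induction hc with
    | refl => exact .refl _
    | step y z n e h j ih => exact .step _ _ _ _ e.1 ih (j.mono hle subset_rfl)

end KPR


namespace KPR

open Finset

lemma marginal {I Ω : Type} [Fintype I] [DecidableEq I] [Fintype Ω] (p : Ω → ℝ) (hp : ∑ a, p a = 1)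
    (F G : Ω → ℝ) (i j : I) (hij : i ≠ j) :
    ∑ g : I → Ω, (∏ i, p (g i)) * (F (g i) * G (g j)) = (∑ a, p a * F a) * (∑ a, p a * G a) := by
  let h : I → Ω → ℝ := fun k a => p a * ((if k = i then F a else 1) * (if k = j then G a else 1))
  have h1 : ∏ k, ∑ a, h k a = ∑ g : I → Ω, ∏ k, h k (g k) := by
    rw [Finset.prod_univ_sum]; simp [Fintype.piFinset_univ]
  have h2 : ∀ g : I → Ω, ∏ k, h k (g k) = (∏ i, p (g i)) * (F (g i) * G (g j)) := by
    intro g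
    simp only [h, Finset.prod_mul_distrib, Finset.prod_ite_eq', Finset.mem_univ, if_true]
  rw [← Finset.sum_congr rfl fun g _ => h2 g, ← h1]
  rw [← Finset.mul_prod_erase _ _ (mem_univ i), ← Finset.mul_prod_erase _ _ 
    (mem_erase.2 ⟨hij.symm, mem_univ j⟩)]
  have h3 : ∏ x ∈ (univ.erase i).erase j, ∑ a, h x a = 1 := by
    refine Finset.prod_eq_one fun k hk => ?_
    simp only [mem_erase, mem_univ, and_true] at hk
    simp [h, hk.1, hk.2, hp]
  rw [h3, mul_one]
  simp [h, hij, hij.symm]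

lemma prob_total {I Ω : Type} [Fintype I] [DecidableEq I] [Fintype Ω] (p : Ω → ℝ)
    (hp : ∑ a, p a = 1) : ∑ g : I → Ω, (∏ i, p (g i)) = 1 := by
  have h1 : ∏ k : I, ∑ a, p a = ∑ g : I → Ω, ∏ k, p (g k) := by
    rw [Finset.prod_univ_sum]; simp [Fintype.piFinset_univ]
  rw [← h1]; simp [hp]

lemma average {I Ω T : Type} [Fintype I] [DecidableEq I] [Fintype Ω] (p : Ω → ℝ)
    (hp0 : ∀ a, 0 ≤ p a) (hp : ∑ a, p a = 1) (s : Finset T)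
    (F G : T → Ω → ℝ) (i j : T → I) (hij : ∀ t ∈ s, i t ≠ j t)
    (h : ∀ g : I → Ω, 1 ≤ ∑ t ∈ s, F t (g (i t)) * G t (g (j t))) :
    1 ≤ ∑ t ∈ s, (∑ a, p a * F t a) * (∑ a, p a * G t a) := by
  rw [← prob_total (I := I) p hp]
  calc _ ≤ ∑ g : I → Ω, (∏ i, p (g i)) * ∑ t ∈ s, F t (g (i t)) * G t (g (j t)) := by
        refine sum_le_sum fun g _ => ?_
        exact le_mul_of_one_le_right (prod_nonneg fun _ _ => hp0 _) (h g)
    _ = ∑ t ∈ s, ∑ g : I → Ω, (∏ i, p (g i)) * (F t (g (i t)) * G t (g (j t))) := by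
        simp only [mul_sum]
        rw [sum_comm]
    _ = _ := sum_congr rfl fun t ht => marginal p hp _ _ _ _ (hij t ht)

variable {X E : Type}

def Valid (Γ : SimpleGraph X) (R : E → Set X) (S : Finset E) (x y : X) : Prop :=
  JI Γ (⋃ e ∈ S, R e) x y

open Classical in
lemma crossing_avg [Fintype X] [Fintype E] (Γ : SimpleGraph X) (R : E → Set X) (h3 : K33Free Γ)
    (w : X → ℝ) (hw : ∀ x, 0 ≤ w x) (hw1 : ∑ x, w x = 1)
    (Sys : Type) [Fintype Sys] (π : Sys → X → X → Finset E) (hπ : ∀ a x y, Valid Γ R (π a x y) x y)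
    (p : Sys → ℝ) (hp0 : ∀ a, 0 ≤ p a) (hp : ∑ a, p a = 1) (c : E → ℝ)
    (hc : ∀ e, c e = ∑ a, p a * ∑ x, ∑ y, w x * w y * (if e ∈ π a x y then 1 else 0)) :
    1 ≤ 36 * ∑ t ∈ (univ : Finset (E × E)).filter (fun t => (R t.1 ∩ R t.2).Nonempty),
      c t.1 * c t.2 := by
  set Tc := (univ : Finset (E × E)).filter (fun t => (R t.1 ∩ R t.2).Nonempty) with hTc
  set I4 : Finset ((Fin 3 × Fin 3) × (Fin 3 × Fin 3)) :=
    univ.filter (fun t => t.1.1 ≠ t.2.1 ∧ t.1.2 ≠ t.2.2) with hI4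
  have cI4 : I4.card = 36 := by rw [hI4]; decide
  let ind : E → Sys → X → X → ℝ := fun e a x y => if e ∈ π a x y then 1 else 0
  have st0 : ∀ (a b : Fin 3 → X) (g : Fin 3 × Fin 3 → Sys),
      1 ≤ ∑ t ∈ I4 ×ˢ Tc, ind t.2.1 (g t.1.1) (a t.1.1.1) (b t.1.1.2) *
        ind t.2.2 (g t.1.2) (a t.1.2.1) (b t.1.2.2) := by
    intro a b g
    obtain ⟨i, k, j, l, hik, hjl, x, hx1, hx2⟩ := h3 a b
      (fun i j => ⋃ e ∈ π (g (i, j)) (a i) (b j), R e) (fun i j => hπ _ _ _)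
    simp only [Set.mem_iUnion, exists_prop] at hx1 hx2
    obtain ⟨e, he, hxe⟩ := hx1
    obtain ⟨f, hf, hxf⟩ := hx2
    refine le_trans ?_ (single_le_sum (f := fun t : ((Fin 3 × Fin 3) × (Fin 3 × Fin 3)) × (E × E) => 
      ind t.2.1 (g t.1.1) (a t.1.1.1) (b t.1.1.2) *
        ind t.2.2 (g t.1.2) (a t.1.2.1) (b t.1.2.2)) (a := (((i, j), (k, l)), (e, f))) ?_ ?_)
    · simp [ind, he, hf]
    · intro t _
      simp only [ind]
      positivity
    · simp only [hTc, hI4, mem_product, mem_filter, mem_univ, true_and]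
      exact ⟨⟨hik, hjl⟩, ⟨x, hxe, hxf⟩⟩
  have hI4m : ∀ t ∈ I4 ×ˢ Tc, t.1.1.1 ≠ t.1.2.1 ∧ t.1.1.2 ≠ t.1.2.2 := by
    intro t ht
    simp only [hI4, mem_product, mem_filter, mem_univ, true_and] at ht
    exact ht.1
  have st1 := fun a b => average p hp0 hp (I4 ×ˢ Tc)
    (fun t π => ind t.2.1 π (a t.1.1.1) (b t.1.1.2)) (fun t π => ind t.2.2 π (a t.1.2.1) (b t.1.2.2))
    (fun t => t.1.1) (fun t => t.1.2) (fun t ht h => (hI4m t ht).1 (congrArg Prod.fst h)) (st0 a b)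
  have st2 := fun b : Fin 3 → X => average w hw hw1 (I4 ×ˢ Tc)
    (fun t x => ∑ π, p π * ind t.2.1 π x (b t.1.1.2)) (fun t x => ∑ π, p π * ind t.2.2 π x (b t.1.2.2))
    (fun t => t.1.1.1) (fun t => t.1.2.1) (fun t ht => (hI4m t ht).1) (fun a => st1 a b)
  have st3 := average w hw hw1 (I4 ×ˢ Tc)
    (fun t y => ∑ x, w x * ∑ π, p π * ind t.2.1 π x y) (fun t y => ∑ x, w x * ∑ π, p π * ind t.2.2 π x y)
    (fun t => t.1.1.2) (fun t => t.1.2.2) (fun t ht => (hI4m t ht).2) (fun b => st2 b)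
  have hc' : ∀ e, ∑ y, w y * ∑ x, w x * ∑ π, p π * ind e π x y = c e := by
    intro e
    rw [hc]
    simp only [mul_sum]
    rw [sum_comm]
    calc _ = ∑ x, ∑ a, ∑ y, w y * (w x * (p a * ind e a x y)) :=
          sum_congr rfl fun x _ => sum_comm
      _ = ∑ a, ∑ x, ∑ y, w y * (w x * (p a * ind e a x y)) := sum_comm
      _ = _ := by
          refine sum_congr rfl fun a _ => sum_congr rfl fun x _ => sum_congr rfl fun y _ => ?_
          simp only [ind]; ring
  simp only [hc'] at st3
  rw [sum_product] at st3
  simp only [sum_const, cI4, nsmul_eq_mul] at st3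
  exact_mod_cast st3

open Classical in
/-- The flow / duality lemma. -/
lemma flow [Fintype X] [Fintype E] (Γ : SimpleGraph X) (R : E → Set X) (h3 : K33Free Γ)
    (hval : ∀ x y, ∃ S, Valid Γ R S x y)
    (w : X → ℝ) (hw : ∀ x, 0 ≤ w x) (hw1 : ∑ x, w x = 1) :
    ∃ ω : E → ℝ, (∀ e, 0 ≤ ω e) ∧
      ∑ e, ω e ≤ 6 * √(((univ : Finset (E × E)).filter
        (fun t => (R t.1 ∩ R t.2).Nonempty)).card) ∧
      ∀ π : X → X → Finset E, (∀ x y, Valid Γ R (π x y) x y) →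
        1 ≤ ∑ x, ∑ y, w x * w y * ∑ e ∈ π x y, ω e := by
  let Sys := {π : X → X → Finset E // ∀ x y, Valid Γ R (π x y) x y}
  let cc : Sys → E → ℝ := fun a e => ∑ x, ∑ y, w x * w y * (if e ∈ a.1 x y then 1 else 0)
  let c : (Sys → ℝ) → E → ℝ := fun p e => ∑ a, p a * cc a e
  let dg : E → ℝ := fun e => ∑ f, if (R e ∩ R f).Nonempty then 1 else 0
  have hdg : ∀ e, 0 ≤ dg e := fun e => sum_nonneg fun f _ => by split_ifs <;> norm_num
  let Q : (Sys → ℝ) → ℝ := fun p => ∑ e, dg e * c p e ^ 2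
  have hQc : Continuous Q := by fun_prop
  choose S0 hS0 using hval
  let π0 : Sys := ⟨S0, hS0⟩
  obtain ⟨p, hp, hmin⟩ := (isCompact_stdSimplex ℝ Sys).exists_isMinOn
    ⟨Pi.single π0 1, single_mem_stdSimplex ℝ π0⟩ hQc.continuousOn
  have hcc : ∀ a e, 0 ≤ cc a e := fun a e => sum_nonneg fun x _ => sum_nonneg fun y _ => by
    have := hw x
    have := hw y
    positivity
  have hcp : ∀ e, 0 ≤ c p e := fun e => sum_nonneg fun a _ => mul_nonneg (hp.1 a) (hcc a e)
  have hQ : 1 ≤ 36 * Q p := by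
    have h := crossing_avg Γ R h3 w hw hw1 Sys (fun a => a.1) (fun a => a.2) p hp.1 hp.2 (c p) (fun e => rfl)
    refine h.trans (mul_le_mul_of_nonneg_left ?_ (by norm_num))
    rw [sum_filter]
    calc _ ≤ ∑ t : E × E, ((if (R t.1 ∩ R t.2).Nonempty then 1 else 0) * (c p t.1 ^ 2 / 2)
          + (if (R t.1 ∩ R t.2).Nonempty then 1 else 0) * (c p t.2 ^ 2 / 2)) := by
          refine sum_le_sum fun t _ => ?_
          split_ifs
          · nlinarith [sq_nonneg (c p t.1 - c p t.2)]
          · simp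
      _ = ∑ e, dg e * (c p e ^ 2 / 2) + ∑ e, dg e * (c p e ^ 2 / 2) := by
          rw [sum_add_distrib]
          congr 1
          · rw [Fintype.sum_prod_type]
            simp only [dg, sum_mul]
          · rw [Fintype.sum_prod_type_right]
            simp only [dg, sum_mul, Set.inter_comm]
      _ = Q p := by
          rw [← sum_add_distrib]
          refine sum_congr rfl fun e _ => by ring
  have hQpos : 0 < Q p := by linarith
  have hfirst : ∀ a : Sys, Q p ≤ ∑ e, dg e * c p e * cc a e := by
    intro a
    set B := ∑ e, dg e * c p e * cc a e with hB
    set C := ∑ e, dg e * (cc a e - c p e) ^ 2 with hC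
    have hCn : 0 ≤ C := sum_nonneg fun e _ => mul_nonneg (hdg e) (sq_nonneg _)
    have key : ∀ t : ℝ, 0 ≤ t → t ≤ 1 → 0 ≤ 2 * t * (B - Q p) + t ^ 2 * C := by
      intro t ht0 ht1
      have hm : (1 - t) • p + t • Pi.single a 1 ∈ stdSimplex ℝ Sys :=
        convex_stdSimplex ℝ Sys hp (single_mem_stdSimplex ℝ a) (by linarith) ht0 (by ring)
      have h1 : Q p ≤ Q ((1 - t) • p + t • Pi.single a 1) := hmin hm
      have h2 : ∀ e, c ((1 - t) • p + t • Pi.single a 1) e = c p e + t * (cc a e - c p e) := by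
        intro e
        simp only [c, Pi.add_apply, Pi.smul_apply, smul_eq_mul, add_mul, sum_add_distrib, mul_assoc,
          ← mul_sum]
        have : ∑ i, (Pi.single a 1 : Sys → ℝ) i * cc i e = cc a e := by
          rw [sum_eq_single a]
          · simp
          · intro b _ hb; simp [hb]
          · simp
        rw [this]; ring
      have h3 : Q ((1 - t) • p + t • Pi.single a 1) = Q p + 2 * t * (B - Q p) + t ^ 2 * C := by
        simp only [Q, h2, hB, hC, mul_sum, ← sum_sub_distrib, ← sum_add_distrib]
        refine sum_congr rfl fun e _ => by ring
      linarith
    by_contra hlt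
    push Not at hlt
    have hd : 0 < Q p - B := by linarith
    have hpos : 0 < Q p - B + C := by linarith
    have := key ((Q p - B) / (Q p - B + C)) (by positivity) (by rw [div_le_one hpos]; linarith)
    set t := (Q p - B) / (Q p - B + C) with ht
    have htp : 0 < t := by positivity
    have : t * C ≤ Q p - B := by
      rw [ht, div_mul_eq_mul_div, div_le_iff₀ hpos]; nlinarith
    nlinarith
  refine ⟨fun e => dg e * c p e / Q p, fun e => div_nonneg (mul_nonneg (hdg e) (hcp e)) hQpos.le, ?_, ?_⟩
  · rw [← sum_div, div_le_iff₀ hQpos]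
    have hT : (((univ : Finset (E × E)).filter
        (fun t => (R t.1 ∩ R t.2).Nonempty)).card : ℝ) = ∑ e, dg e := by
      rw [card_filter]; push_cast
      rw [Fintype.sum_prod_type]
    rw [hT]
    have hcs := Finset.sum_sq_le_sum_mul_sum_of_sq_le_mul univ (r := fun e => dg e * c p e)
      (f := dg) (g := fun e => dg e * c p e ^ 2) (fun e _ => hdg e)
      (fun e _ => mul_nonneg (hdg e) (sq_nonneg _)) (fun e _ => le_of_eq (by ring))
    have h1 : ∑ e, dg e * c p e ≤ √((∑ e, dg e) * Q p) := Real.le_sqrt_of_sq_le hcs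
    refine h1.trans ?_
    rw [Real.sqrt_mul (sum_nonneg fun e _ => hdg e)]
    have h2 : √(Q p) ≤ 6 * Q p := by
      rw [Real.sqrt_le_left (by positivity)]
      nlinarith
    nlinarith [Real.sqrt_nonneg (∑ e, dg e)]
  · intro π hπ
    have h := hfirst ⟨π, hπ⟩
    rw [← one_le_div hQpos] at h
    refine h.trans (le_of_eq ?_)
    simp only [cc]
    calc _ = ∑ e, ∑ x, ∑ y, w x * w y * (if e ∈ π x y then dg e * c p e / Q p else 0) := by
          rw [sum_div]
          refine sum_congr rfl fun e _ => ?_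
          simp only [mul_sum, sum_div]
          refine sum_congr rfl fun x _ => sum_congr rfl fun y _ => ?_
          split_ifs <;> ring
      _ = ∑ x, ∑ y, ∑ e, w x * w y * (if e ∈ π x y then dg e * c p e / Q p else 0) := by
          rw [sum_comm]
          exact sum_congr rfl fun x _ => sum_comm
      _ = _ := by
          refine sum_congr rfl fun x _ => sum_congr rfl fun y _ => ?_
          rw [← mul_sum, sum_ite_mem, univ_inter]

end KPR


namespace KPR

open Finset

variable {X E : Type}

open Classical in
lemma conn_valid (R : E → Set X) (ω : E → ℕ) (Γ : SimpleGraph X) {x y : X} {n : ℕ}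
    (h : Conn R ω Γ x y n) : x = y ∨ ∃ S, Valid Γ R S x y ∧ ∑ e ∈ S, ω e ≤ n := by
  induction h with
  | refl => exact .inl rfl
  | step y z n e h j ih =>
    right
    rcases ih with rfl | ⟨S, hS, hn⟩
    · refine ⟨{e}, ?_, by simp⟩
      simpa [Valid] using j
    · refine ⟨insert e S, ?_, ?_⟩
      · refine JI.trans (hS.mono le_rfl ?_) (j.mono le_rfl ?_)
        · exact Set.biUnion_subset_biUnion_left fun f hf => by simp [hf]
        · intro q hq
          simp only [Set.mem_iUnion, exists_prop]
          exact ⟨e, by simp, hq⟩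
      · by_cases he : e ∈ S
        · rw [insert_eq_of_mem he]; omega
        · rw [sum_insert he]; omega

open Classical in
lemma metric [Fintype X] [Fintype E] (Γ : SimpleGraph X) (R : E → Set X) (h3 : K33Free Γ)
    (h2 : ∀ p q, Γ.Adj p q → ∃ e, p ∈ R e ∧ q ∈ R e)
    (hconn : ∀ x y, Γ.Reachable x y)
    (w : X → ℝ) (hw : ∀ x, 0 ≤ w x) (hw1 : ∑ x, w x = 1) (hw3 : ∀ x, w x ≤ 1 / 3) (N : ℝ) :
    ∃ (ω : E → ℕ) (D : X → X → ℕ), (∀ e, 1 ≤ ω e) ∧ (∀ x y, Conn R ω Γ x y (D x y)) ∧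
      (∀ x y n, Conn R ω Γ x y n → D x y ≤ n) ∧
      N ≤ ∑ x, ∑ y, w x * w y * D x y ∧
      (∑ e, ω e : ℝ) ≤ 18 * √(((univ : Finset (E × E)).filter
        (fun t => (R t.1 ∩ R t.2).Nonempty)).card) * ∑ x, ∑ y, w x * w y * D x y := by
  have hother : ∀ x : X, ∃ y, y ≠ x := by
    intro x
    by_contra hcon
    push Not at hcon
    have : ∑ y, w y = w x := by
      rw [sum_eq_single x]
      · intro b _ hb; exact absurd (hcon b) hb
      · simp
    have := hw3 x
    linarith
  have hval : ∀ x y, ∃ S, Valid Γ R S x y := by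
    have aux : ∀ x y, x ≠ y → ∃ S, Valid Γ R S x y := by
      intro x y hxy
      obtain ⟨n, hn⟩ := Conn.of_reach (ω := fun _ => 0) h2 (hconn x y)
      rcases conn_valid R _ Γ hn with h | ⟨S, hS, -⟩
      · exact absurd h hxy
      · exact ⟨S, hS⟩
    intro x y
    by_cases hxy : x = y
    · subst hxy
      obtain ⟨y, hy⟩ := hother x
      obtain ⟨S, hS⟩ := aux x y hy.symm
      exact ⟨S, .refl _ hS.left⟩
    · exact aux x y hxy
  obtain ⟨ω0, hω0, hsum, hsys⟩ := flow Γ R h3 hval w hw hw1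
  set T : ℝ := √(((univ : Finset (E × E)).filter
        (fun t => (R t.1 ∩ R t.2).Nonempty)).card) with hT
  have hΩpos : 0 < ∑ e, ω0 e := by
    choose S0 hS0 using hval
    by_contra hle
    have hz : ∑ e, ω0 e = 0 := le_antisymm (not_lt.1 hle) (sum_nonneg fun e _ => hω0 e)
    have hz' : ∀ e, ω0 e = 0 := fun e => (sum_eq_zero_iff_of_nonneg (fun e _ => hω0 e)).1 hz e (mem_univ e)
    have := hsys S0 hS0
    simp [hz'] at this
    linarith
  obtain ⟨K, hK0, hK1, hK2⟩ : ∃ K : ℝ, 0 < K ∧ 2 * (Fintype.card E : ℝ) ≤ K * ∑ e, ω0 e ∧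
      N ≤ K * (2 / 3) := by
    refine ⟨max 1 (max (2 * (Fintype.card E : ℝ) / ∑ e, ω0 e) (N * (3 / 2))), by positivity, ?_, ?_⟩
    · rw [← div_le_iff₀ hΩpos]
      exact (le_max_left _ _).trans (le_max_right _ _)
    · have : N * (3 / 2) ≤ max 1 (max (2 * (Fintype.card E : ℝ) / ∑ e, ω0 e) (N * (3 / 2))) :=
        (le_max_right _ _).trans (le_max_right _ _)
      linarith
  let ω : E → ℕ := fun e => ⌈K * ω0 e⌉₊ + 1
  have hωge : ∀ e, K * ω0 e ≤ ω e := by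
    intro e
    have := Nat.le_ceil (K * ω0 e)
    simp only [ω]; push_cast; linarith
  have hωle : ∀ e, (ω e : ℝ) ≤ K * ω0 e + 2 := by
    intro e
    have := Nat.ceil_lt_add_one (mul_nonneg hK0.le (hω0 e))
    simp only [ω]; push_cast; linarith
  have hex : ∀ x y, ∃ n, Conn R ω Γ x y n := fun x y => Conn.of_reach h2 (hconn x y)
  let D : X → X → ℕ := fun x y => Nat.find (hex x y)
  have hD : ∀ x y, Conn R ω Γ x y (D x y) := fun x y => Nat.find_spec (hex x y)
  have hS : ∀ x y, ∃ S, x ≠ y → Valid Γ R S x y ∧ ∑ e ∈ S, ω e ≤ D x y := by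
    intro x y
    rcases conn_valid R ω Γ (hD x y) with h | ⟨S, hS, hn⟩
    · exact ⟨∅, fun h' => absurd h h'⟩
    · exact ⟨S, fun _ => ⟨hS, hn⟩⟩
  choose S hS using hS
  have hy0 : ∀ x, ∃ y0, y0 ≠ x ∧ ∀ y, y ≠ x → ∑ e ∈ S x y0, ω0 e ≤ ∑ e ∈ S x y, ω0 e := by
    intro x
    obtain ⟨y1, hy1⟩ := hother x
    obtain ⟨y0, h1, h2⟩ := exists_min_image (univ.filter fun y => y ≠ x) (fun y => ∑ e ∈ S x y, ω0 e)
      ⟨y1, by simp [hy1]⟩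
    exact ⟨y0, by simpa using h1, fun y hy => h2 y (by simp [hy])⟩
  choose y0 hy0 hy0m using hy0
  let π : X → X → Finset E := fun x y => if x = y then S x (y0 x) else S x y
  have hπ : ∀ x y, Valid Γ R (π x y) x y := by
    intro x y
    simp only [π]
    split_ifs with h
    · subst h
      exact .refl _ (hS x (y0 x) (hy0 x).symm).1.left
    · exact (hS x y h).1
  have h1 := hsys π hπ
  have hrow : ∀ x, ∑ y, w y * ∑ e ∈ π x y, ω0 e ≤ (3 / 2) * (∑ y, w y * (D x y : ℝ)) / K := by
    intro x
    have hd : ∀ y, y ≠ x → ∑ e ∈ π x y, ω0 e ≤ D x y / K := by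
      intro y hy
      rw [le_div_iff₀ hK0, sum_mul]
      have := (hS x y hy.symm).2
      simp only [π, if_neg hy.symm]
      calc _ ≤ ∑ e ∈ S x y, (ω e : ℝ) := sum_le_sum fun e _ => by rw [mul_comm]; exact hωge e
        _ ≤ _ := by exact_mod_cast this
    have hdiag : ∀ y, y ≠ x → ∑ e ∈ π x x, ω0 e ≤ ∑ e ∈ π x y, ω0 e := by
      intro y hy
      simp only [π, if_neg hy.symm, if_true]
      exact hy0m x y hy
    rw [← add_sum_erase _ _ (mem_univ x), ← add_sum_erase (a := x) _ _ (mem_univ x)]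
    set A := ∑ e ∈ π x x, ω0 e with hA
    have hA0 : 0 ≤ A := sum_nonneg fun e _ => hω0 e
    have hwe : ∑ y ∈ univ.erase x, w y = 1 - w x := by
      rw [← hw1, ← add_sum_erase univ w (mem_univ x)]; ring
    have e1 : (1 - w x) * A ≤ ∑ y ∈ univ.erase x, w y * ∑ e ∈ π x y, ω0 e := by
      rw [← hwe, sum_mul]
      exact sum_le_sum fun y hy => mul_le_mul_of_nonneg_left (hdiag y (ne_of_mem_erase hy)) (hw y)
    have e2 : ∑ y ∈ univ.erase x, w y * ∑ e ∈ π x y, ω0 e ≤ (∑ y ∈ univ.erase x, w y * (D x y : ℝ)) / K := by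
      rw [sum_div]
      refine sum_le_sum fun y hy => ?_
      rw [mul_div_assoc]
      exact mul_le_mul_of_nonneg_left (hd y (ne_of_mem_erase hy)) (hw y)
    have e3 : 0 ≤ w x * (D x x : ℝ) / K := by
      have := hw x
      positivity
    have e4 := hw3 x
    have e5 : (3 / 2) * (w x * (D x x : ℝ) + ∑ y ∈ univ.erase x, w y * (D x y : ℝ)) / K
      = (3 / 2) * (w x * (D x x : ℝ) / K) + (3 / 2) * ((∑ y ∈ univ.erase x, w y * (D x y : ℝ)) / K) := by ring
    rw [e5]
    nlinarith
  have hDav : K * (2 / 3) ≤ ∑ x, ∑ y, w x * w y * (D x y : ℝ) := by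
    have : ∑ x, ∑ y, w x * w y * ∑ e ∈ π x y, ω0 e ≤ (3 / 2) * (∑ x, ∑ y, w x * w y * (D x y : ℝ)) / K := by
      rw [mul_sum, sum_div]
      refine sum_le_sum fun x _ => ?_
      simp only [mul_assoc, ← mul_sum]
      have := mul_le_mul_of_nonneg_left (hrow x) (hw x)
      calc _ ≤ _ := this
        _ = _ := by ring
    have h := h1.trans this
    rw [le_div_iff₀ hK0] at h
    linarith
  refine ⟨ω, D, fun e => by simp [ω], hD, fun x y n hn => Nat.find_min' (hex x y) hn, hK2.trans hDav, ?_⟩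
  have hT0 : 0 ≤ T := Real.sqrt_nonneg _
  calc (∑ e, ω e : ℝ) ≤ ∑ e, (K * ω0 e + 2) := sum_le_sum fun e _ => hωle e
    _ = K * ∑ e, ω0 e + 2 * Fintype.card E := by
        rw [sum_add_distrib, ← mul_sum]; simp [mul_comm]
    _ ≤ 2 * K * (6 * T) := by nlinarith
    _ = 18 * T * (K * (2 / 3)) := by ring
    _ ≤ _ := mul_le_mul_of_nonneg_left hDav (by positivity)

end KPR


namespace KPR

open Finset

variable {X E : Type}

open Classical in
noncomputable def cutS [Fintype E] (R : E → Set X) (A : Finset X) : Finset E :=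
  univ.filter fun e => ∃ p ∈ R e, ∃ q ∈ R e, p ∈ A ∧ q ∉ A

open Classical in
lemma cutS_compl [Fintype X] [Fintype E] (R : E → Set X) (A : Finset X) : cutS R Aᶜ = cutS R A := by
  ext e
  simp only [cutS, mem_filter, mem_univ, true_and, mem_compl, not_not]
  constructor <;> rintro ⟨p, hp, q, hq, h1, h2⟩ <;> exact ⟨q, hq, p, hp, h2, h1⟩

open Classical in
lemma sweep [Fintype X] [Fintype E] (R : E → Set X) (w : X → ℝ) (hw : ∀ x, 0 ≤ w x) (f : X → ℕ)
    (ω : E → ℕ) (hf : ∀ e, ∀ p ∈ R e, ∀ q ∈ R e, f q ≤ f p + ω e)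
    (hpos : 0 < ∑ x, w x * f x) :
    ∃ t : ℕ, 0 < t ∧ 0 < ∑ x ∈ univ.filter (fun x => t ≤ f x), w x ∧
      ((cutS R (univ.filter fun x => t ≤ f x)).card : ℝ) * ∑ x, w x * f x ≤
        (∑ e, ω e : ℝ) * ∑ x ∈ univ.filter (fun x => t ≤ f x), w x := by
  obtain ⟨x0, hx0, hx0m⟩ : ∃ x0, 0 < w x0 ∧ ∀ x, 0 < w x → f x ≤ f x0 := by
    have hne : (univ.filter fun x => 0 < w x).Nonempty := by
      by_contra hcon
      rw [not_nonempty_iff_eq_empty, filter_eq_empty_iff] at hcon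
      have : ∑ x, w x * f x = 0 := sum_eq_zero fun x _ => by
        have h1 := hcon (mem_univ x)
        have h2 := hw x
        have : w x = 0 := by linarith
        rw [this, zero_mul]
      linarith
    obtain ⟨x0, h1, h2⟩ := exists_max_image _ f hne
    exact ⟨x0, by simpa using h1, fun x hx => h2 x (by simpa using hx)⟩
  set M := f x0 with hM
  have hcount : ∀ n m : ℕ, n ≤ m → ((Icc 1 m).filter fun t => t ≤ n).card = n := by
    intro n m h
    have : (Icc 1 m).filter (fun t => t ≤ n) = Icc 1 n := by
      ext t; simp only [mem_filter, mem_Icc]; omega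
    rw [this]; simp
  have hsumw : ∑ t ∈ Icc 1 M, ∑ x ∈ univ.filter (fun x => t ≤ f x), w x = ∑ x, w x * f x := by
    simp only [sum_filter]
    rw [sum_comm]
    refine sum_congr rfl fun x _ => ?_
    rw [← sum_filter, sum_const, nsmul_eq_mul, mul_comm]
    rcases (hw x).eq_or_lt with h | h
    · rw [← h]; simp
    · rw [hcount _ _ (hx0m x h)]
  have hcut : ∑ t ∈ Icc 1 M, ((cutS R (univ.filter fun x => t ≤ f x)).card : ℝ) ≤ ∑ e, (ω e : ℝ) := by
    simp only [cutS, card_filter]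
    push_cast
    rw [sum_comm]
    refine sum_le_sum fun e _ => ?_
    rw [← sum_filter, sum_const, nsmul_eq_mul, mul_one]
    norm_cast
    rcases (R e).eq_empty_or_nonempty with hR | hR
    · simp [hR]
    · obtain ⟨r, hr, hrm⟩ : ∃ r ∈ R e, ∀ q ∈ R e, f r ≤ f q := by
        have hex : ∃ n, ∃ r ∈ R e, f r = n := ⟨_, _, hR.choose_spec, rfl⟩
        obtain ⟨r, hr, hrn⟩ := Nat.find_spec hex
        exact ⟨r, hr, fun q hq => hrn ▸ Nat.find_min' hex ⟨q, hq, rfl⟩⟩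
      refine le_trans (card_le_card (t := Ioc (f r) (f r + ω e)) ?_) (by simp)
      intro t ht
      simp only [mem_filter, mem_univ, true_and, mem_Icc, mem_Ioc, not_le] at ht ⊢
      obtain ⟨-, p, hp, q, hq, h1, h2⟩ := ht
      have := hrm q hq
      have := hf e r hr p hp
      omega
  by_contra hcon
  push Not at hcon
  have hM1 : 1 ≤ M := by
    by_contra h
    have hM0 : M = 0 := by omega
    rw [hM0] at hsumw
    simp at hsumw
    linarith
  have hall : ∀ t ∈ Icc 1 M, (∑ e, ω e : ℝ) * ∑ x ∈ univ.filter (fun x => t ≤ f x), w x <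
      ((cutS R (univ.filter fun x => t ≤ f x)).card : ℝ) * ∑ x, w x * f x := by
    intro t ht
    rw [mem_Icc] at ht
    refine hcon t (by omega) ?_
    refine lt_of_lt_of_le hx0 (single_le_sum (f := w) (fun x _ => hw x) ?_)
    simp; omega
  have := sum_lt_sum_of_nonempty (nonempty_Icc.2 hM1) hall
  rw [← mul_sum, hsumw, ← sum_mul] at this
  nlinarith

open Classical in
lemma pack [Fintype X] (H : SimpleGraph X) (w : X → ℝ) (hw : ∀ x, 0 ≤ w x) (hw1 : ∑ x, w x = 1)
    (hcomp : ∀ v, ∑ x ∈ univ.filter (fun x => H.Reachable v x), w x < 1 / 4) :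
    ∃ A : Finset X, (∀ x ∈ A, ∀ y, H.Reachable x y → y ∈ A) ∧ ∑ x ∈ A, w x ≤ 1 / 2 ∧
      1 / 4 ≤ ∑ x ∈ A, w x := by
  obtain ⟨A, hA, hAm⟩ := exists_max_image
    ((univ : Finset (Finset X)).filter fun A => (∀ x ∈ A, ∀ y, H.Reachable x y → y ∈ A) ∧
      ∑ x ∈ A, w x ≤ 1 / 2) Finset.card ⟨∅, by simp⟩
  simp only [mem_filter, mem_univ, true_and] at hA hAm
  refine ⟨A, hA.1, hA.2, ?_⟩
  by_contra hlt
  push Not at hlt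
  obtain ⟨v, hv⟩ : ∃ v, v ∉ A := by
    by_contra hcon
    push Not at hcon
    have : A = univ := eq_univ_iff_forall.2 hcon
    rw [this, hw1] at hlt
    norm_num at hlt
  have h1 := hAm (A ∪ univ.filter fun x => H.Reachable v x) ⟨?_, ?_⟩
  · have hss : A ⊂ A ∪ univ.filter fun x => H.Reachable v x := by
      refine ⟨subset_union_left, fun h => hv (h ?_)⟩
      simp
    have := card_lt_card hss
    omega
  · intro x hx y hxy
    simp only [mem_union, mem_filter, mem_univ, true_and] at hx ⊢
    rcases hx with hx | hx
    · exact .inl (hA.1 x hx y hxy)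
    · exact .inr (hx.trans hxy)
  · have h2 := sum_union_inter (s₁ := A) (s₂ := univ.filter fun x => H.Reachable v x) (f := w)
    have h3 : 0 ≤ ∑ x ∈ A ∩ univ.filter (fun x => H.Reachable v x), w x := sum_nonneg fun x _ => hw x
    have h4 := hcomp v
    linarith

open Classical in
theorem abstract_cut [Fintype X] [Fintype E] (Γ : SimpleGraph X) (R : E → Set X) (h3 : K33Free Γ)
    (h1 : ∀ e, ∀ p ∈ R e, ∀ q ∈ R e, JI Γ (R e) p q)
    (h2 : ∀ p q, Γ.Adj p q → ∃ e, p ∈ R e ∧ q ∈ R e)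
    (w : X → ℝ) (hw : ∀ x, 0 ≤ w x) (hw1 : ∑ x, w x = 1) (hw3 : ∀ x, w x ≤ 1 / 3)
    (hR : ∀ e, ∑ x ∈ univ.filter (fun x => x ∈ R e), w x < 1)
    (Y : Set X) (hY : ∀ x, ∃ y ∈ Y, Γ.Reachable x y) (hwY : ∀ x, x ∉ Y → w x = 0) :
    ∃ A : Finset X, (∃ x ∈ A, x ∈ Y) ∧ ∑ x ∈ A, w x ≤ 1 / 2 ∧
      ((cutS R A).card : ℝ) ≤ 200000 * √(((univ : Finset (E × E)).filter
        (fun t => t.1 ≠ t.2 ∧ (R t.1 ∩ R t.2).Nonempty)).card) * ∑ x ∈ A, w x := by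
  set T' := ((univ : Finset (E × E)).filter
        (fun t => t.1 ≠ t.2 ∧ (R t.1 ∩ R t.2).Nonempty)).card with hT'
  by_cases hconn : ∀ x y, Γ.Reachable x y
  swap
  · push Not at hconn
    obtain ⟨x, y, hxy⟩ := hconn
    have comp : ∀ v, ∑ x ∈ univ.filter (fun x => Γ.Reachable v x), w x ≤ 1 / 2 →
        ∃ A : Finset X, (∃ x ∈ A, x ∈ Y) ∧ ∑ x ∈ A, w x ≤ 1 / 2 ∧
      ((cutS R A).card : ℝ) ≤ 200000 * √T' * ∑ x ∈ A, w x := by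
      intro v hv
      refine ⟨_, ?_, hv, ?_⟩
      · obtain ⟨y, hy, hvy⟩ := hY v
        exact ⟨y, by simpa using hvy, hy⟩
      · have : cutS R (univ.filter fun x => Γ.Reachable v x) = ∅ := by
          rw [eq_empty_iff_forall_notMem]
          intro e he
          simp only [cutS, mem_filter, mem_univ, true_and] at he
          obtain ⟨p, hp, q, hq, hp', hq'⟩ := he

          exact hq' (hp'.trans (h1 e p hp q hq).reach)
        rw [this]
        have : 0 ≤ ∑ x ∈ univ.filter (fun x => Γ.Reachable v x), w x := sum_nonneg fun x _ => hw x
        simp only [card_empty, Nat.cast_zero]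
        positivity
    by_cases hx : ∑ z ∈ univ.filter (fun z => Γ.Reachable x z), w z ≤ 1 / 2
    · exact comp x hx
    · refine comp y ?_
      push Not at hx
      have hd : Disjoint (univ.filter (fun z => Γ.Reachable x z)) (univ.filter (fun z => Γ.Reachable y z)) := by
        rw [disjoint_left]
        intro z hz hz'
        simp only [mem_filter, mem_univ, true_and] at hz hz'
        exact hxy (hz.trans hz'.symm)
      have h4 := sum_union hd (f := w)
      have h5 := sum_le_sum_of_subset_of_nonneg (f := w) (subset_univ (univ.filter (fun z => Γ.Reachable x z) ∪ (univ.filter (fun z => Γ.Reachable y z)))) (fun x _ _ => hw x)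
      linarith
  -- connected case
  set T := ((univ : Finset (E × E)).filter (fun t => (R t.1 ∩ R t.2).Nonempty)).card with hT
  have hTT : T ≤ 2 * T' := by
    have hnb : ∀ e, (R e).Nonempty → ∃ f, e ≠ f ∧ (R e ∩ R f).Nonempty := by
      rintro e ⟨p, hp⟩
      obtain ⟨q, hq⟩ : ∃ q, q ∉ R e := by
        by_contra hcon
        push Not at hcon
        have := hR e
        simp only [hcon, filter_true, hw1] at this
        exact lt_irrefl _ this
      have hj := JI.of_reach (hconn p q)
      rcases hj.split (R e)ᶜ (by simpa using hp) with h | ⟨a, b, ha, hab, -, hb⟩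
      · have := h.right.2
        simp [hq] at this
      · obtain ⟨f, hf1, hf2⟩ := h2 a b hab
        have ha' : a ∈ R e := by simpa using ha.right.2
        refine ⟨f, ?_, a, ha', hf1⟩
        rintro rfl
        exact hb hf2
    choose! nb hnb1 hnb2 using hnb
    have hsplit : (univ : Finset (E × E)).filter (fun t => (R t.1 ∩ R t.2).Nonempty) ⊆
        ((univ : Finset E).filter fun e => (R e).Nonempty).image (fun e => (e, e)) ∪
        (univ : Finset (E × E)).filter (fun t => t.1 ≠ t.2 ∧ (R t.1 ∩ R t.2).Nonempty) := by
      rintro ⟨e, f⟩ h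
      simp only [mem_filter, mem_univ, true_and, mem_union, mem_image, Prod.mk.injEq] at h ⊢
      by_cases hef : e = f
      · subst hef
        exact .inl ⟨e, by simpa using h, rfl, rfl⟩
      · exact .inr ⟨hef, h⟩
    have c1 := (card_le_card hsplit).trans (card_union_le _ _)
    have c2 : (((univ : Finset E).filter fun e => (R e).Nonempty).image (fun e => (e, e))).card ≤ T' := by
      refine card_image_le.trans ?_
      refine card_le_card_of_injOn (fun e => (e, nb e)) ?_ ?_
      · intro e he
        simp only [coe_filter, mem_univ, true_and] at he ⊢
        exact ⟨hnb1 e he, hnb2 e he⟩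
      · intro a _ b _ h
        exact (Prod.mk.inj h).1
    omega
  have hsT : √(T : ℝ) ≤ 2 * √(T' : ℝ) := by
    have : (T : ℝ) ≤ 2 * T' := by exact_mod_cast hTT
    calc √(T : ℝ) ≤ √(2 ^ 2 * T') := Real.sqrt_le_sqrt (by nlinarith [Nat.cast_nonneg (α := ℝ) T'])
      _ = 2 * √(T' : ℝ) := by rw [Real.sqrt_mul (by norm_num), Real.sqrt_sq (by norm_num)]
  obtain ⟨ω, D, hω, hD, hDm, hN, hsum⟩ := metric Γ R h3 h2 hconn w hw hw1 hw3 200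
  rw [← hT] at hsum
  set Dav := ∑ x, ∑ y, w x * w y * (D x y : ℝ) with hDav
  have hsym : ∀ x y, D x y = D y x := fun x y =>
    le_antisymm (hDm _ _ _ (hD y x).symm) (hDm _ _ _ (hD x y).symm)
  have htri : ∀ x y z, D x z ≤ D x y + D y z := fun x y z => hDm _ _ _ ((hD x y).trans (hD y z))
  have hlip : ∀ x e, ∀ p ∈ R e, ∀ q ∈ R e, D x q ≤ D x p + ω e := fun x e p hp q hq =>
    hDm _ _ _ ((hD x p).trans (Conn.one (h1 e p hp q hq)))
  set τ := ⌊Dav / 200⌋₊ with hτ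
  have hτ1 : 0 < τ := Nat.floor_pos.2 (by linarith)
  have hτle : (τ : ℝ) ≤ Dav / 200 := Nat.floor_le (by linarith)
  have hτge : Dav / 400 ≤ τ := by
    have := Nat.lt_floor_add_one (Dav / 200)
    have : (1 : ℝ) ≤ τ := by exact_mod_cast hτ1
    linarith
  have hYof : ∀ A : Finset X, 0 < ∑ x ∈ A, w x → ∃ x ∈ A, x ∈ Y := by
    intro A hA
    by_contra hcon
    push Not at hcon
    have : ∑ x ∈ A, w x = 0 := sum_eq_zero fun x hx => hwY x (hcon x hx)
    linarith
  have hs0 : 0 ≤ √(T' : ℝ) := Real.sqrt_nonneg _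
  by_cases hball : ∃ x, 1 / 8 ≤ ∑ y ∈ univ.filter (fun y => D x y ≤ 21 * τ), w y
  · obtain ⟨x, hx⟩ := hball
    let f : X → ℕ := fun y => D x y - 21 * τ
    have hS : Dav / 4 ≤ ∑ y, w y * (f y : ℝ) := by
      have e1 : Dav ≤ 2 * ∑ y, w y * (D x y : ℝ) := by
        calc Dav ≤ ∑ y, ∑ z, (w z * (w y * (D x y : ℝ)) + w y * (w z * (D x z : ℝ))) := by
              refine sum_le_sum fun y _ => sum_le_sum fun z _ => ?_
              have : (D y z : ℝ) ≤ D x y + D x z := by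
                have := htri y x z
                rw [hsym y x] at this
                exact_mod_cast this
              have := mul_le_mul_of_nonneg_left this (mul_nonneg (hw y) (hw z))
              linarith
          _ = 2 * ∑ y, w y * (D x y : ℝ) := by
              simp only [sum_add_distrib, ← mul_sum, ← sum_mul, hw1]
              ring
      have e2 : ∑ y, w y * (D x y : ℝ) ≤ ∑ y, w y * (f y : ℝ) + 21 * τ := by
        calc _ ≤ ∑ y, (w y * (f y : ℝ) + w y * (21 * τ)) := by
              refine sum_le_sum fun y _ => ?_
              rw [← mul_add]
              refine mul_le_mul_of_nonneg_left ?_ (hw y)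
              have : D x y ≤ f y + 21 * τ := by simp only [f]; omega
              exact_mod_cast this
          _ = _ := by rw [sum_add_distrib, ← sum_mul, hw1]; ring
      linarith
    obtain ⟨t, ht0, htw, htc⟩ := sweep R w hw f ω (fun e p hp q hq => by
      have := hlip x e p hp q hq
      simp only [f]; omega) (by linarith)
    set A := univ.filter fun x => t ≤ f x with hA
    have hA1 : ∑ x ∈ A, w x ≤ 1 := by
      rw [← hw1]; exact sum_le_sum_of_subset_of_nonneg (subset_univ _) (fun x _ _ => hw x)
    have hc : ((cutS R A).card : ℝ) ≤ 144 * √(T' : ℝ) * ∑ x ∈ A, w x := by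
      have e1 : ((cutS R A).card : ℝ) * (Dav / 4) ≤ 18 * (2 * √(T' : ℝ)) * Dav * ∑ x ∈ A, w x := by
        calc _ ≤ ((cutS R A).card : ℝ) * ∑ x, w x * f x :=
              mul_le_mul_of_nonneg_left hS (Nat.cast_nonneg _)
          _ ≤ _ := htc
          _ ≤ _ := by
              refine mul_le_mul_of_nonneg_right (hsum.trans ?_) htw.le
              have : 0 ≤ Dav := by linarith
              gcongr
      have : 0 < Dav := by linarith
      have : ((cutS R A).card : ℝ) * Dav ≤ (144 * √(T' : ℝ) * ∑ x ∈ A, w x) * Dav := by linarith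
      exact le_of_mul_le_mul_right this ‹0 < Dav›
    by_cases hhalf : ∑ x ∈ A, w x ≤ 1 / 2
    · refine ⟨A, hYof A htw, hhalf, hc.trans ?_⟩
      gcongr
      norm_num
    · push Not at hhalf
      have hcs : ∑ x ∈ A, w x + ∑ x ∈ Aᶜ, w x = 1 := by rw [sum_add_sum_compl, hw1]
      have hB : 1 / 8 ≤ ∑ x ∈ Aᶜ, w x := by
        refine hx.trans (sum_le_sum_of_subset_of_nonneg ?_ (fun x _ _ => hw x))
        intro y hy
        simp only [hA, f, mem_filter, mem_univ, true_and, mem_compl] at hy ⊢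
        omega
      refine ⟨Aᶜ, hYof _ (by linarith), by linarith, ?_⟩
      rw [cutS_compl]
      nlinarith
  · push Not at hball
    obtain ⟨H, hcut, hthree⟩ := chop_thm R ω Γ h3 h1 τ hτ1 hω
    have hcomp : ∀ v, ∑ x ∈ univ.filter (fun x => H.Reachable v x), w x < 1 / 4 := by
      intro v
      obtain ⟨u, hu⟩ : ∃ u, univ.filter (fun x => H.Reachable v x) ⊆
          univ.filter (fun y => D v y ≤ 21 * τ) ∪ univ.filter (fun y => D u y ≤ 21 * τ) := by
        by_cases hall : ∀ x, H.Reachable v x → D v x ≤ 21 * τ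
        · refine ⟨v, ?_⟩
          intro x hx
          simp only [mem_filter, mem_univ, true_and, mem_union] at hx ⊢
          exact .inl (hall x hx)
        · push Not at hall
          obtain ⟨u, hvu, hu⟩ := hall
          refine ⟨u, ?_⟩
          intro x hx
          simp only [mem_filter, mem_univ, true_and, mem_union] at hx ⊢
          have hr : ∀ i, H.Reachable v (![v, u, x] i) := by
            intro i
            fin_cases i
            · exact .refl _
            · exact hvu
            · exact hx
          obtain ⟨i, j, hij, n, hn, hc⟩ := hthree ![v, u, x] (fun i j => (hr i).symm.trans (hr j))
          have hd := (hDm _ _ _ hc).trans hn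
          have s1 := hsym u v
          have s2 := hsym x v
          have s3 := hsym x u
          fin_cases i <;> fin_cases j <;> simp at hij hd <;> omega
      have h4 := sum_union_inter (s₁ := univ.filter (fun y => D v y ≤ 21 * τ)) (s₂ := univ.filter (fun y => D u y ≤ 21 * τ)) (f := w)
      have h5 : 0 ≤ ∑ x ∈ univ.filter (fun y => D v y ≤ 21 * τ) ∩ univ.filter (fun y => D u y ≤ 21 * τ), w x := sum_nonneg fun x _ => hw x
      have h6 := sum_le_sum_of_subset_of_nonneg hu (fun x _ _ => hw x)
      have h7 := hball v
      have h8 := hball u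
      linarith
    obtain ⟨A, hAc, hA2, hA4⟩ := pack H w hw hw1 hcomp
    refine ⟨A, hYof A (by linarith), hA2, ?_⟩
    have hc1 : (τ : ℝ) * (cutS R A).card ≤ 3 * ∑ e, (ω e : ℝ) := by
      have := (Nat.mul_le_mul_left τ (card_le_card (s := cutS R A) ?_)).trans hcut
      · exact_mod_cast this
      intro e he
      simp only [cutS, mem_filter, mem_univ, true_and] at he ⊢
      obtain ⟨p, hp, q, hq, hpA, hqA⟩ := he
      intro hall
      exact hqA (hAc p hpA q (hall p hp q hq))
    have hc2 : Dav / 400 * (cutS R A).card ≤ 3 * (18 * (2 * √(T' : ℝ)) * Dav) := by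
      have e1 : Dav / 400 * ((cutS R A).card : ℝ) ≤ τ * (cutS R A).card :=
        mul_le_mul_of_nonneg_right hτge (Nat.cast_nonneg _)
      have : 0 ≤ Dav := by linarith
      have e2 : 18 * √(T : ℝ) * Dav ≤ 18 * (2 * √(T' : ℝ)) * Dav := by gcongr
      linarith
    have hc3 : ((cutS R A).card : ℝ) ≤ 43200 * √(T' : ℝ) := by
      have : 0 < Dav := by linarith
      have : ((cutS R A).card : ℝ) * Dav ≤ (43200 * √(T' : ℝ)) * Dav := by linarith
      exact le_of_mul_le_mul_right this ‹0 < Dav›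
    nlinarith

end KPR


namespace DrawEx
open Set

lemma quad_finite (A B C : ℝ) (hA : A ≠ 0) : {x : ℝ | A * x ^ 2 + B * x + C = 0}.Finite := by
  classical
  let p : Polynomial ℝ := .C A * .X ^ 2 + .C B * .X + .C C
  have hp : p ≠ 0 := by
    intro h
    have := Polynomial.natDegree_quadratic (b := B) (c := C) hA
    have h2 : p.natDegree = 2 := this
    rw [h] at h2
    simp at h2
  refine (p.roots.toFinset.finite_toSet).subset ?_
  intro x hx
  have hx' : A * x ^ 2 + B * x + C = 0 := hx
  simp only [Finset.mem_coe, Multiset.mem_toFinset, Polynomial.mem_roots hp, Polynomial.IsRoot.def]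
  simpa [p] using hx'

variable {E : Type} (a b : E → ℝ)

/-- the parabola -/
def q (e : E) (x : ℝ) : ℝ := (x - a e) * (b e - x)

lemma eq_finite (e f : E) (l m : ℝ) (h : l ≠ m) : {x | l * q a b e x = m * q a b f x}.Finite := by
  refine (quad_finite (m - l) (l * (a e + b e) - m * (a f + b f)) (m * a f * b f - l * a e * b e)
    (sub_ne_zero.2 h.symm)).subset ?_
  intro x hx
  have hx' : l * ((x - a e) * (b e - x)) = m * ((x - a f) * (b f - x)) := hx
  show _ = _
  linear_combination hx'

lemma exists_lam (s : Finset E) : ∃ l : E → ℝ, (∀ e, 0 < l e) ∧ (∀ e ∈ s, ∀ f ∈ s, e ≠ f → l e ≠ l f) ∧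
    ∀ e ∈ s, ∀ f ∈ s, ∀ g ∈ s, e ≠ f → f ≠ g → e ≠ g → ∀ x, 0 < q a b e x → 0 < q a b f x →
      0 < q a b g x → l e * q a b e x = l f * q a b f x → l f * q a b f x = l g * q a b g x → False := by
  classical
  induction s using Finset.induction_on with
  | empty => exact ⟨fun _ => 1, fun _ => one_pos, by simp, by simp⟩
  | insert g s hg ih =>
    obtain ⟨l, hpos, hne, htri⟩ := ih
    have hB : (l '' (s : Set E) ∪ ⋃ e ∈ s, ⋃ f ∈ s, ⋃ (_ : e ≠ f),
        (fun x => l e * q a b e x / q a b g x) '' {x | l e * q a b e x = l f * q a b f x}).Finite := by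
      refine (s.finite_toSet.image l).union ?_
      refine s.finite_toSet.biUnion fun e he => s.finite_toSet.biUnion fun f hf =>
        Set.finite_iUnion fun h => (eq_finite a b e f _ _ (hne e he f hf h)).image _
    obtain ⟨L, hL, hLB⟩ := ((Set.Ioi_infinite (0:ℝ)).diff hB).nonempty
    have hL1 : ∀ e ∈ s, l e ≠ L := fun e he h => hLB (.inl ⟨e, he, h⟩)
    have hL2 : ∀ e ∈ s, ∀ f ∈ s, e ≠ f → ∀ x, 0 < q a b g x → l e * q a b e x = l f * q a b f x →
        L * q a b g x = l e * q a b e x → False := by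
      intro e he f hf hef x hx h1 h2
      refine hLB (.inr ?_)
      simp only [Set.mem_iUnion]
      refine ⟨e, he, f, hf, hef, x, h1, ?_⟩
      simp only
      rw [← h2]
      field_simp
    have hup : ∀ e ∈ s, Function.update l g L e = l e := fun e he =>
      Function.update_of_ne (ne_of_mem_of_not_mem he hg) _ _
    refine ⟨Function.update l g L, ?_, ?_, ?_⟩
    · intro e
      by_cases h : e = g
      · subst h; simpa using hL
      · rw [Function.update_of_ne h]; exact hpos e
    · intro e he f hf hef
      rw [Finset.mem_insert] at he hf
      rcases he with rfl | he <;> rcases hf with rfl | hf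
      · exact absurd rfl hef
      · rw [hup f hf]; simpa using (hL1 f hf).symm
      · rw [hup e he]; simpa using hL1 e he
      · rw [hup e he, hup f hf]; exact hne e he f hf hef
    · intro e he f hf k hk hef hfk hek x h1 h2 h3 h4 h5
      rw [Finset.mem_insert] at he hf hk
      rcases he with rfl | he
      · have hf := hf.resolve_left hef.symm
        have hk := hk.resolve_left hek.symm
        rw [hup f hf, Function.update_self] at h4
        rw [hup f hf, hup k hk] at h5
        exact hL2 f hf k hk hfk x h1 h5 h4
      rw [hup e he] at h4
      rcases hf with rfl | hf
      · have hk := hk.resolve_left hfk.symm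
        rw [Function.update_self] at h4 h5
        rw [hup k hk] at h5
        exact hL2 e he k hk hek x h2 (h4.trans h5) h4.symm
      rw [hup f hf] at h4 h5
      rcases hk with rfl | hk
      · rw [Function.update_self] at h5
        exact hL2 e he f hf hef x h3 h4 (h4.trans h5).symm
      rw [hup k hk] at h5
      exact htri e he f hf k hk hef hfk hek x h1 h2 h3 h4 h5

theorem exists_drawing {n : ℕ} (G : SimpleGraph (Fin n)) : Nonempty (Drawing G) := by
  classical
  have hij : ∀ e : G.edgeSet, ∃ i j : Fin n, i < j ∧ (e : Sym2 (Fin n)) = s(i, j) := by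
    rintro ⟨e, he⟩
    induction e with
    | _ i j =>
      have hne : i ≠ j := G.ne_of_adj he
      rcases lt_or_gt_of_ne hne with h | h
      · exact ⟨i, j, h, rfl⟩
      · exact ⟨j, i, h, Sym2.eq_swap⟩
  choose i j hlt he using hij
  have hltR : ∀ e, ((i e : ℕ) : ℝ) < ((j e : ℕ) : ℝ) := fun e => by exact_mod_cast hlt e
  obtain ⟨l, hpos, hne, htri⟩ := exists_lam (fun e : G.edgeSet => ((i e : ℕ) : ℝ)) (fun e => ((j e : ℕ) : ℝ))
    Finset.univ
  set Q := q (fun e : G.edgeSet => ((i e : ℕ) : ℝ)) (fun e => ((j e : ℕ) : ℝ)) with hQ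
  let X : G.edgeSet → ℝ → ℝ := fun e t => ((i e : ℕ) : ℝ) + t * (((j e : ℕ) : ℝ) - ((i e : ℕ) : ℝ))
  have hXinj : ∀ e s t, X e s = X e t → s = t := by
    intro e s t h
    have h1 := hltR e
    simp only [X, add_right_inj] at h
    exact mul_right_cancel₀ (by linarith) h
  have hXpos : ∀ e, ∀ t ∈ Ioo (0:ℝ) 1, 0 < Q e (X e t) := by
    intro e t ht
    have h1 := hltR e
    have : Q e (X e t) = t * (1 - t) * (((j e : ℕ) : ℝ) - ((i e : ℕ) : ℝ)) ^ 2 := by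
      simp only [hQ, q, X]; ring
    rw [this]
    have h2 := ht.1
    have h3 : 0 < 1 - t := by linarith [ht.2]
    have h4 : 0 < ((j e : ℕ) : ℝ) - ((i e : ℕ) : ℝ) := by linarith
    positivity
  have hXc : ∀ e, Continuous (X e) := fun e => by fun_prop
  have hQc : ∀ e, Continuous (Q e) := fun e => by
    have : Q e = fun x => (x - ((i e : ℕ) : ℝ)) * (((j e : ℕ) : ℝ) - x) := rfl
    rw [this]; fun_prop
  refine ⟨⟨fun v => (((v : ℕ) : ℝ), 0), ?_, fun e t => (X e t, l e * Q e (X e t)), ?_, ?_, ?_, ?_, ?_, ?_⟩⟩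
  · intro u v h
    have := congrArg Prod.fst h
    simp only [Nat.cast_inj] at this
    exact Fin.ext this
  · intro e
    have := hXc e
    have := hQc e
    fun_prop
  · intro e s _ t _ h
    exact hXinj e s t (congrArg Prod.fst h)
  · intro e
    refine ⟨i e, j e, he e, ?_, ?_⟩
    · simp [X, hQ, q]
    · simp [X, hQ, q]
  · rintro e t ht ⟨v, hv⟩
    have := congrArg Prod.snd hv
    simp only at this
    have h2 := mul_pos (hpos e) (hXpos e t ht)
    linarith
  · intro e f hef
    refine ((eq_finite (fun e : G.edgeSet => ((i e : ℕ) : ℝ)) (fun e => ((j e : ℕ) : ℝ)) e f _ _ (hne e (Finset.mem_univ _) f (Finset.mem_univ _) hef)).image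
      fun x => (x, l e * Q e x)).subset ?_
    rintro _ ⟨⟨t, -, rfl⟩, ⟨s, -, hs⟩⟩
    have h1 := congrArg Prod.fst hs
    have h2 := congrArg Prod.snd hs
    simp only at h1 h2
    refine ⟨X e t, ?_, rfl⟩
    rw [h1] at h2
    exact h2.symm
  · rintro e f g hef hfg heg p ⟨⟨t, ht, rfl⟩, ⟨s, hs, hs'⟩, ⟨r, hr, hr'⟩⟩
    have h1 := congrArg Prod.fst hs'
    have h2 := congrArg Prod.snd hs'
    have h3 := congrArg Prod.fst hr'
    have h4 := congrArg Prod.snd hr'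
    simp only at h1 h2 h3 h4
    have p1 := hXpos e t ht
    have p2 := hXpos f s hs
    have p3 := hXpos g r hr
    rw [h1] at h2 p2
    rw [h3] at h4 p3
    exact htri e (Finset.mem_univ _) f (Finset.mem_univ _) g (Finset.mem_univ _) hef hfg heg _ p1 p2 p3
      h2.symm (h2.trans h4.symm)

end DrawEx


namespace Arr
open KPR Set

variable {E : Type} (c : E → ℝ → ℝ × ℝ) (X0 : Set (ℝ × ℝ))

/-- an arc of the arrangement: a piece of a curve between consecutive nodes. -/
def Arc (e : E) (s t : ℝ) : Prop :=
  s ∈ Icc (0:ℝ) 1 ∧ t ∈ Icc (0:ℝ) 1 ∧ s < t ∧ c e s ∈ X0 ∧ c e t ∈ X0 ∧ ∀ u ∈ Ioo s t, c e u ∉ X0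

/-- the arrangement graph -/
def gr : SimpleGraph X0 where
  Adj p q := p ≠ q ∧ ∃ e s t, Arc c X0 e s t ∧
    ((c e s = p ∧ c e t = q) ∨ (c e s = q ∧ c e t = p))
  symm := ⟨by
    rintro p q ⟨h, e, s, t, ha, hh⟩
    exact ⟨h.symm, e, s, t, ha, hh.symm⟩⟩
  loopless := ⟨fun p h => h.1 rfl⟩

/-- nodes on a curve -/
def on (e : E) : Set X0 := {x | x.1 ∈ c e '' Icc 0 1}

variable {c X0}

lemma joined_times (hX : X0.Finite) (hinj : ∀ e, InjOn (c e) (Icc 0 1)) (e : E) :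
    ∀ n : ℕ, ∀ s t, ∀ hs : s ∈ Icc (0:ℝ) 1, ∀ ht : t ∈ Icc (0:ℝ) 1, s < t →
    ∀ hs' : c e s ∈ X0, ∀ ht' : c e t ∈ X0, {u | u ∈ Ioo s t ∧ c e u ∈ X0}.ncard ≤ n →
    JI (gr c X0) (on c X0 e) ⟨c e s, hs'⟩ ⟨c e t, ht'⟩ := by
  have hfin : ∀ s t, s ∈ Icc (0:ℝ) 1 → t ∈ Icc (0:ℝ) 1 → {u | u ∈ Ioo s t ∧ c e u ∈ X0}.Finite := by
    intro s t hs ht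
    refine Set.Finite.of_finite_image (f := c e) (hX.subset ?_) ((hinj e).mono ?_)
    · rintro _ ⟨u, hu, rfl⟩
      exact hu.2
    · rintro u ⟨hu, -⟩
      exact ⟨hs.1.trans hu.1.le, hu.2.le.trans ht.2⟩
  intro n
  induction n with
  | zero =>
    intro s t hs ht hst hs' ht' hn
    have h0 : {u | u ∈ Ioo s t ∧ c e u ∈ X0} = ∅ := by
      rw [← Set.ncard_eq_zero (hfin s t hs ht)]; omega
    refine JI.adj ⟨?_, e, s, t, ⟨hs, ht, hst, hs', ht', ?_⟩, .inl ⟨rfl, rfl⟩⟩ ⟨s, hs, rfl⟩ ⟨t, ht, rfl⟩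
    · intro h
      exact hst.ne (hinj e hs ht (congrArg Subtype.val h))
    · intro u hu hu'
      have : u ∈ {u | u ∈ Ioo s t ∧ c e u ∈ X0} := ⟨hu, hu'⟩
      rw [h0] at this
      exact this
  | succ n ih =>
    intro s t hs ht hst hs' ht' hn
    by_cases h0 : ∃ u ∈ Ioo s t, c e u ∈ X0
    · obtain ⟨u, hu, hu'⟩ := h0
      have huI : u ∈ Icc (0:ℝ) 1 := ⟨hs.1.trans hu.1.le, hu.2.le.trans ht.2⟩
      refine (ih s u hs huI hu.1 hs' hu' ?_).trans (ih u t huI ht hu.2 hu' ht' ?_)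
      · have : {v | v ∈ Ioo s u ∧ c e v ∈ X0}.ncard < {u | u ∈ Ioo s t ∧ c e u ∈ X0}.ncard := by
          refine Set.ncard_lt_ncard ?_ (hfin s t hs ht)
          refine ⟨fun v hv => ⟨⟨hv.1.1, hv.1.2.trans hu.2⟩, hv.2⟩, fun h => ?_⟩
          exact lt_irrefl _ (h (⟨hu, hu'⟩ : u ∈ {u | u ∈ Ioo s t ∧ c e u ∈ X0})).1.2
        omega
      · have : {v | v ∈ Ioo u t ∧ c e v ∈ X0}.ncard < {u | u ∈ Ioo s t ∧ c e u ∈ X0}.ncard := by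
          refine Set.ncard_lt_ncard ?_ (hfin s t hs ht)
          refine ⟨fun v hv => ⟨⟨hu.1.trans hv.1.1, hv.1.2⟩, hv.2⟩, fun h => ?_⟩
          exact lt_irrefl _ (h (⟨hu, hu'⟩ : u ∈ {u | u ∈ Ioo s t ∧ c e u ∈ X0})).1.1
        omega
    · push Not at h0
      refine JI.adj ⟨?_, e, s, t, ⟨hs, ht, hst, hs', ht', h0⟩, .inl ⟨rfl, rfl⟩⟩ ⟨s, hs, rfl⟩ ⟨t, ht, rfl⟩
      intro h
      exact hst.ne (hinj e hs ht (congrArg Subtype.val h))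

lemma joined_on (hX : X0.Finite) (hinj : ∀ e, InjOn (c e) (Icc 0 1)) (e : E) :
    ∀ p ∈ on c X0 e, ∀ q ∈ on c X0 e, JI (gr c X0) (on c X0 e) p q := by
  rintro ⟨p, hp'⟩ ⟨s, hs, hp⟩ ⟨q, hq'⟩ ⟨t, ht, hq⟩
  dsimp only at hp hq
  subst hp hq
  rcases lt_trichotomy s t with h | h | h
  · exact joined_times hX hinj e _ s t hs ht h hp' hq' le_rfl
  · subst h
    exact .refl _ ⟨s, hs, rfl⟩
  · exact (joined_times hX hinj e _ t s ht hs h hq' hp' le_rfl).symm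

lemma adj_on {p q : X0} (h : (gr c X0).Adj p q) : ∃ e, p ∈ on c X0 e ∧ q ∈ on c X0 e := by
  obtain ⟨-, e, s, t, ha, hh⟩ := h
  refine ⟨e, ?_⟩
  rcases hh with ⟨h1, h2⟩ | ⟨h1, h2⟩
  · exact ⟨⟨s, ha.1, h1⟩, ⟨t, ha.2.1, h2⟩⟩
  · exact ⟨⟨t, ha.2.1, h2⟩, ⟨s, ha.1, h1⟩⟩

variable (c X0) in
/-- the plane set carried by a set of nodes -/
def hat (P : Set X0) : Set (ℝ × ℝ) :=
  Subtype.val '' P ∪ {z | ∃ e s t, Arc c X0 e s t ∧ (∃ p ∈ P, p.1 = c e s) ∧ (∃ p ∈ P, p.1 = c e t) ∧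
    ∃ u ∈ Ioo s t, z = c e u}

lemma hat_joined (hcont : ∀ e, ContinuousOn (c e) (Icc 0 1)) {P : Set X0} {x y : X0}
    (h : JI (gr c X0) P x y) : JoinedIn (hat c X0 P) x y := by
  induction h with
  | refl hx => exact JoinedIn.refl (.inl ⟨x, hx, rfl⟩)
  | step y z h1 a b ih =>
    refine ih.trans ?_
    obtain ⟨-, e, s, t, ha, hh⟩ := a
    have hy := h1.right
    have key : ∀ y z : X0, y ∈ P → z ∈ P → c e s = y → c e t = z → JoinedIn (hat c X0 P) y z := by
      intro y z hy hz hs ht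
      have hpc : IsPathConnected (c e '' Icc s t) := by
        refine IsPathConnected.image' ((convex_Icc s t).isPathConnected ⟨s, le_rfl, ha.2.2.1.le⟩) ?_
        exact (hcont e).mono fun u hu => ⟨ha.1.1.trans hu.1, hu.2.trans ha.2.1.2⟩
      have hj := hpc.joinedIn y ⟨s, ⟨le_rfl, ha.2.2.1.le⟩, hs⟩ z ⟨t, ⟨ha.2.2.1.le, le_rfl⟩, ht⟩
      refine hj.mono ?_
      rintro _ ⟨u, hu, rfl⟩
      rcases hu.1.eq_or_lt with h | h
      · subst h
        exact .inl ⟨y, hy, hs.symm⟩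
      rcases hu.2.eq_or_lt with h' | h'
      · subst h'
        exact .inl ⟨z, hz, ht.symm⟩
      exact .inr ⟨e, s, t, ha, ⟨y, hy, hs.symm⟩, ⟨z, hz, ht.symm⟩, u, ⟨h, h'⟩, rfl⟩
    rcases hh with ⟨h2, h3⟩ | ⟨h2, h3⟩
    · exact key y z hy b h2 h3
    · exact (key z y b hy h2 h3).symm

lemma hat_inter (hinj : ∀ e, InjOn (c e) (Icc 0 1))
    (hcap : ∀ e f, e ≠ f → c e '' Icc 0 1 ∩ c f '' Icc 0 1 ⊆ X0)
    {P Q : Set X0} (h : (hat c X0 P ∩ hat c X0 Q).Nonempty) : (P ∩ Q).Nonempty := by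
  obtain ⟨z, hz1, hz2⟩ := h
  rcases hz1 with ⟨p, hp, hpz⟩ | ⟨e, s, t, ha, hs, ht, u, hu, rfl⟩
  · rcases hz2 with ⟨q, hq, hqz⟩ | ⟨e, s, t, ha, hs, ht, u, hu, rfl⟩
    · have : p = q := Subtype.ext (hpz.trans hqz.symm)
      subst this
      exact ⟨p, hp, hq⟩
    · exact absurd (hpz ▸ p.2) (ha.2.2.2.2.2 u hu)
  · rcases hz2 with ⟨q, hq, hqz⟩ | ⟨f, s', t', hb, hs', ht', v, hv, huv⟩
    · exact absurd (hqz ▸ q.2) (ha.2.2.2.2.2 u hu)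
    · have huI : u ∈ Icc (0:ℝ) 1 := ⟨ha.1.1.trans hu.1.le, hu.2.le.trans ha.2.1.2⟩
      have hvI : v ∈ Icc (0:ℝ) 1 := ⟨hb.1.1.trans hv.1.le, hv.2.le.trans hb.2.1.2⟩
      have hef : e = f := by
        by_contra hne
        exact ha.2.2.2.2.2 u hu (hcap e f hne ⟨⟨u, huI, rfl⟩, ⟨v, hvI, huv.symm⟩⟩)
      subst hef
      have := hinj e huI hvI huv
      subst this
      have hss : s = s' := by
        rcases lt_trichotomy s s' with h | h | h
        · exact absurd hb.2.2.2.1 (ha.2.2.2.2.2 s' ⟨h, hv.1.trans hu.2⟩)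
        · exact h
        · exact absurd ha.2.2.2.1 (hb.2.2.2.2.2 s ⟨h, hu.1.trans hv.2⟩)
      subst hss
      obtain ⟨p, hp, hp1⟩ := hs
      obtain ⟨q, hq, hq1⟩ := hs'
      have : p = q := Subtype.ext (hp1.trans hq1.symm)
      subst this
      exact ⟨p, hp, hq⟩

lemma k33free (hcont : ∀ e, ContinuousOn (c e) (Icc 0 1)) (hinj : ∀ e, InjOn (c e) (Icc 0 1))
    (hcap : ∀ e f, e ≠ f → c e '' Icc 0 1 ∩ c f '' Icc 0 1 ⊆ X0) : K33Free (gr c X0) := by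
  intro a b P hP
  obtain ⟨i, k, j, l, h1, h2, h3⟩ := K33.k33_joined (fun i => (a i).1) (fun i => (b i).1)
    (fun i j => hat c X0 (P i j)) (fun i j => hat_joined hcont (hP i j))
  exact ⟨i, k, j, l, h1, h2, hat_inter hinj hcap h3⟩

end Arr

namespace Drawing
open KPR Set Arr Finset

variable {V : Type} {G : SimpleGraph V} (D : Drawing G)

/-- nodes of the arrangement -/
def nodes : Set (ℝ × ℝ) :=
  Set.range D.pos ∪ ⋃ (e : G.edgeSet), ⋃ (f : G.edgeSet), ⋃ (_ : e ≠ f),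
    (D.curve e '' Set.Icc 0 1 ∩ D.curve f '' Set.Icc 0 1)

lemma ends_mem (e : G.edgeSet) {u : V} (hu : u ∈ (e : Sym2 V)) :
    D.pos u ∈ D.curve e '' Set.Icc 0 1 := by
  obtain ⟨a, b, he, h0, h1⟩ := D.curve_ends e
  rw [he, Sym2.mem_iff] at hu
  rcases hu with rfl | rfl
  · exact ⟨0, by simp, h0⟩
  · exact ⟨1, by simp, h1⟩

lemma mem_of_pos (e : G.edgeSet) {u : V} (hu : D.pos u ∈ D.curve e '' Set.Icc 0 1) :
    u ∈ (e : Sym2 V) := by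
  obtain ⟨a, b, he, h0, h1⟩ := D.curve_ends e
  obtain ⟨t, ht, htu⟩ := hu
  rw [he, Sym2.mem_iff]
  rcases ht.1.eq_or_lt with h | h
  · subst h
    exact .inl (D.pos_inj (htu.symm.trans h0))
  rcases ht.2.eq_or_lt with h' | h'
  · subst h'
    exact .inr (D.pos_inj (htu.symm.trans h1))
  · exact absurd ⟨u, htu.symm⟩ (D.curve_avoid e t ⟨h, h'⟩)

lemma nodes_finite [Fintype V] : D.nodes.Finite := by
  have : Finite G.edgeSet := Subtype.finite
  refine (Set.finite_range _).union ?_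
  refine Set.finite_iUnion fun e => Set.finite_iUnion fun f => Set.finite_iUnion fun h =>
    D.curve_finite_inter e f h

lemma cap_nodes (e f : G.edgeSet) (h : e ≠ f) :
    D.curve e '' Set.Icc 0 1 ∩ D.curve f '' Set.Icc 0 1 ⊆ D.nodes := by
  intro z hz
  refine .inr ?_
  simp only [Set.mem_iUnion]
  exact ⟨e, f, h, hz⟩

open scoped Classical in
theorem drawing_cut [Fintype V] (w : V → ℝ) (hw : ∀ v, 0 ≤ w v) (hw1 : ∑ v, w v = 1) (hw3 : ∀ v, w v ≤ 1 / 3) :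
    ∃ A : Finset V, A.Nonempty ∧ ∑ v ∈ A, w v ≤ 1 / 2 ∧
      (({e : Sym2 V | e ∈ G.edgeSet ∧ ∃ u v, e = s(u, v) ∧ u ∈ A ∧ v ∉ A}.ncard : ℕ) : ℝ) ≤
        200000 * √(({t : G.edgeSet × G.edgeSet | t.1 ≠ t.2 ∧
          (D.curve t.1 '' Set.Icc 0 1 ∩ D.curve t.2 '' Set.Icc 0 1).Nonempty}.ncard : ℕ) : ℝ) *
        ∑ v ∈ A, w v := by
  haveI : Fintype D.nodes := D.nodes_finite.fintype
  have hposn : ∀ v, D.pos v ∈ D.nodes := fun v => .inl ⟨v, rfl⟩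
  let P : V → D.nodes := fun v => ⟨D.pos v, hposn v⟩
  have hPinj : Function.Injective P := fun u v h => D.pos_inj (congrArg Subtype.val h)
  let w' : D.nodes → ℝ := fun x => ∑ v, if P v = x then w v else 0
  have hsum : ∀ A : Finset D.nodes, ∑ x ∈ A, w' x = ∑ v ∈ univ.filter (fun v => P v ∈ A), w v := by
    intro A
    simp only [w']
    rw [sum_comm, sum_filter]
    refine sum_congr rfl fun v _ => ?_
    rw [sum_ite_eq]
  have hw'P : ∀ v, w' (P v) = w v := by
    intro v
    simp only [w', hPinj.eq_iff]
    simp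
  have hw'0 : ∀ x, x ∉ Set.range P → w' x = 0 := by
    intro x hx
    refine sum_eq_zero fun v _ => if_neg fun h => hx ⟨v, h⟩
  have hon : ∀ e v, P v ∈ on D.curve D.nodes e ↔ v ∈ (e : Sym2 V) :=
    fun e v => ⟨D.mem_of_pos e, D.ends_mem e⟩
  obtain ⟨A, ⟨x, hxA, v, rfl⟩, hA2, hA3⟩ := abstract_cut (gr D.curve D.nodes) (on D.curve D.nodes)
    (k33free D.curve_cont D.curve_inj D.cap_nodes) (joined_on D.nodes_finite D.curve_inj)
    (fun p q h => adj_on h) w'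
    (fun x => sum_nonneg fun v _ => by split_ifs <;> simp [hw])
    (by rw [hsum]; simpa using hw1)
    (by
      intro x
      by_cases hx : x ∈ Set.range P
      · obtain ⟨v, rfl⟩ := hx
        rw [hw'P]; exact hw3 v
      · rw [hw'0 x hx]; norm_num)
    (by
      intro e
      rw [hsum]
      obtain ⟨a, b, he, -⟩ := D.curve_ends e
      have : ∑ v ∈ univ.filter (fun v => P v ∈ univ.filter (fun x => x ∈ on D.curve D.nodes e)), w v
          ≤ ∑ v ∈ {a, b}, w v := by
        refine sum_le_sum_of_subset_of_nonneg ?_ fun v _ _ => hw v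
        intro v hv
        simp only [mem_filter, Finset.mem_univ, true_and, hon, he, Sym2.mem_iff] at hv
        simpa using hv
      have h2 : ∑ v ∈ {a, b}, w v ≤ w a + w b := by
        by_cases hab : a = b
        · subst hab; simp [hw]
        · rw [sum_pair hab]
      have := hw3 a
      have := hw3 b
      linarith)
    (Set.range P)
    (by
      rintro ⟨x, hx⟩
      rcases hx with ⟨v, rfl⟩ | hx
      · exact ⟨P v, ⟨v, rfl⟩, SimpleGraph.Reachable.refl _⟩
      · have hx' := hx
        simp only [Set.mem_iUnion] at hx'
        obtain ⟨e, f, hef, hz, -⟩ := hx'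
        obtain ⟨a, b, he, -⟩ := D.curve_ends e
        refine ⟨P a, ⟨a, rfl⟩, (joined_on D.nodes_finite D.curve_inj e _ hz _ ?_).reach⟩
        rw [hon, he]; simp)
    (fun x hx => hw'0 x hx)
  refine ⟨univ.filter (fun v => P v ∈ A), ⟨v, by simpa using hxA⟩, ?_, ?_⟩
  · rw [← hsum]; exact hA2
  · rw [← hsum]
    refine le_trans ?_ (hA3.trans (le_of_eq ?_))
    · have hle : {e : Sym2 V | e ∈ G.edgeSet ∧ ∃ u v, e = s(u, v) ∧ u ∈ univ.filter (fun v => P v ∈ A) ∧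
          v ∉ univ.filter (fun v => P v ∈ A)} ⊆
          Subtype.val '' (↑(cutS (on D.curve D.nodes) A) : Set G.edgeSet) := by
        rintro e ⟨he, u, v, rfl, hu, hv⟩
        refine ⟨⟨s(u, v), he⟩, ?_, rfl⟩
        simp only [mem_filter, Finset.mem_univ, true_and] at hu hv
        simp only [cutS, Finset.coe_filter, Finset.mem_univ, true_and, Set.mem_ofPred_eq]
        exact ⟨P u, (hon _ _).2 (by simp), P v, (hon _ _).2 (by simp), hu, hv⟩
      have h1 := Set.ncard_le_ncard hle (Set.toFinite _)
      have h2 := h1.trans (Set.ncard_image_le (Set.toFinite _))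
      rw [Set.ncard_coe_finset] at h2
      exact_mod_cast h2
    · congr 4
      rw [← Set.ncard_coe_finset]
      congr 1
      ext t
      simp only [Finset.coe_filter, Finset.mem_univ, true_and, Set.mem_ofPred_eq]
      refine and_congr_right fun hne => ?_
      constructor
      · rintro ⟨x, hx1, hx2⟩
        exact ⟨x.1, hx1, hx2⟩
      · rintro ⟨x, hx1, hx2⟩
        exact ⟨⟨x, D.cap_nodes _ _ hne ⟨hx1, hx2⟩⟩, hx1, hx2⟩

end Drawing


namespace Drawing
open Finset

variable {V : Type} {G : SimpleGraph V} (D : Drawing G)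

/-- edge map of an induced subgraph -/
def emap (G : SimpleGraph V) (S : Set V) : (G.induce S).edgeSet ↪ G.edgeSet :=
  (SimpleGraph.Embedding.induce S).mapEdgeSet

lemma emap_val (S : Set V) (e : (G.induce S).edgeSet) :
    ((emap G S e : G.edgeSet) : Sym2 V) = (e : Sym2 S).map Subtype.val := rfl

/-- restriction of a drawing to an induced subgraph -/
def restrict (S : Set V) : Drawing (G.induce S) where
  pos v := D.pos v
  pos_inj := D.pos_inj.comp Subtype.val_injective
  curve e := D.curve (emap G S e)
  curve_cont e := D.curve_cont _
  curve_inj e := D.curve_inj _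
  curve_ends e := by
    obtain ⟨u, v, h, h0, h1⟩ := D.curve_ends (emap G S e)
    rw [emap_val] at h
    obtain ⟨e, he⟩ := e
    induction e with
    | _ a b =>
      simp only [Sym2.map_mk, Sym2.eq_iff] at h
      rcases h with ⟨rfl, rfl⟩ | ⟨rfl, rfl⟩
      · exact ⟨a, b, rfl, h0, h1⟩
      · exact ⟨b, a, Sym2.eq_swap, h0, h1⟩
  curve_avoid e t ht := by
    rintro ⟨v, hv⟩
    exact D.curve_avoid _ t ht ⟨v, hv⟩
  curve_finite_inter e f h := D.curve_finite_inter _ _ fun h' => h ((emap G S).injective h')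
  no_triple_point e f g h1 h2 h3 := D.no_triple_point _ _ _ (fun h' => h1 ((emap G S).injective h'))
    (fun h' => h2 ((emap G S).injective h')) (fun h' => h3 ((emap G S).injective h'))

/-- the crossing graph -/
def Cg : SimpleGraph G.edgeSet where
  Adj e f := e ≠ f ∧ ∃ p, D.IsCross e f p
  symm := ⟨by
    rintro e f ⟨h, p, h1, h2⟩
    exact ⟨h.symm, p, h2, h1⟩⟩
  loopless := ⟨fun p h => h.1 rfl⟩

lemma Cg_edgeSet : D.Cg.edgeSet = D.crossingPairs := by
  ext x
  induction x with
  | _ e f =>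
    constructor
    · intro h
      exact ⟨e, f, h.1, rfl, h.2⟩
    · rintro ⟨e', f', h, h1, h2⟩
      rw [h1]
      exact ⟨h, h2⟩

lemma touch_cases (e f : G.edgeSet) (hne : e ≠ f)
    (h : (D.curve e '' Set.Icc 0 1 ∩ D.curve f '' Set.Icc 0 1).Nonempty) :
    D.Cg.Adj e f ∨ ∃ v, v ∈ (e : Sym2 V) ∧ v ∈ (f : Sym2 V) := by
  obtain ⟨p, hp1, hp2⟩ := h
  by_cases hv : ∃ v, D.pos v = p
  · obtain ⟨v, rfl⟩ := hv
    exact .inr ⟨v, D.mem_of_pos e hp1, D.mem_of_pos f hp2⟩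
  · have key : ∀ e : G.edgeSet, p ∈ D.curve e '' Set.Icc 0 1 → p ∈ D.curve e '' Set.Ioo 0 1 := by
      rintro e ⟨t, ht, rfl⟩
      obtain ⟨a, b, -, h0, h1⟩ := D.curve_ends e
      refine ⟨t, ⟨ht.1.lt_of_ne ?_, ht.2.lt_of_ne ?_⟩, rfl⟩
      · rintro rfl; exact hv ⟨a, h0.symm⟩
      · rintro rfl; exact hv ⟨b, h1.symm⟩
    exact .inl ⟨hne, p, key e hp1, key f hp2⟩

lemma inc_card {V : Type} [Fintype V] {G : SimpleGraph V} [DecidableEq V] [Fintype G.edgeSet] (v : V) :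
    ((univ : Finset G.edgeSet).filter (fun e : G.edgeSet => v ∈ (e : Sym2 V))).card = (G.neighborSet v).ncard := by
  have h1 : (G.neighborSet v).ncard = (G.incidenceSet v).ncard :=
    (Nat.card_congr (G.incidenceSetEquivNeighborSet v)).symm
  rw [h1, ← Set.ncard_coe_finset, ← Set.ncard_image_of_injective _ Subtype.val_injective]
  congr 1
  ext e
  simp only [Set.mem_image, SetLike.mem_coe, mem_filter, Finset.mem_univ, true_and]
  constructor
  · rintro ⟨f, hf, rfl⟩
    exact ⟨f.2, hf⟩
  · rintro ⟨h, h'⟩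
    exact ⟨⟨e, h⟩, h', rfl⟩

variable [Fintype V]

lemma sum_Cg [Fintype G.edgeSet] :
    ∑ e : G.edgeSet, (D.Cg.neighborSet e).ncard = 2 * D.numCrossingPairs := by
  classical
  have h := D.Cg.sum_degrees_eq_twice_card_edges
  rw [numCrossingPairs, ← Cg_edgeSet, Set.ncard_eq_toFinset_card']
  rw [SimpleGraph.edgeFinset] at h
  rw [← h]
  refine sum_congr rfl fun e _ => ?_
  rw [Set.ncard_eq_toFinset_card']
  rfl

open scoped Classical in
/-- vertex weights -/
noncomputable def W (v : V) : ℝ :=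
  ((G.neighborSet v).ncard.choose 2 : ℕ) +
    1 / 4 * ∑ e : G.edgeSet, if v ∈ (e : Sym2 V) then ((D.Cg.neighborSet e).ncard : ℝ) else 0

lemma W_nonneg (v : V) : 0 ≤ D.W v := by
  unfold W
  refine add_nonneg (Nat.cast_nonneg _) (mul_nonneg (by norm_num) (sum_nonneg fun e _ => ?_))
  split_ifs <;> simp

open scoped Classical in
lemma sum_W (S : Finset V) : ∑ v ∈ S, D.W v = ∑ v ∈ S, (((G.neighborSet v).ncard.choose 2 : ℕ) : ℝ) +
    1 / 4 * ∑ e : G.edgeSet, ((S.filter (fun v => v ∈ (e : Sym2 V))).card : ℝ) *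
      ((D.Cg.neighborSet e).ncard : ℝ) := by
  unfold W
  rw [sum_add_distrib, ← mul_sum, sum_comm]
  congr 2
  refine sum_congr rfl fun e _ => ?_
  rw [← sum_filter, sum_const, nsmul_eq_mul]

lemma sum_W_univ : ∑ v, D.W v = (D.numCrossingPairs : ℝ) + (bds G : ℝ) := by
  classical
  rw [sum_W, bds, finsum_eq_sum_of_fintype]
  have h1 : ∀ e : G.edgeSet, ((univ : Finset V).filter (fun v => v ∈ (e : Sym2 V))).card = 2 := by
    rintro ⟨e, he⟩
    induction e with
    | _ a b =>
      have hne : a ≠ b := G.ne_of_adj he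
      rw [← card_pair hne]
      congr 1
      ext v
      simp
  have h2 : ∑ e : G.edgeSet, ((D.Cg.neighborSet e).ncard : ℝ) = 2 * D.numCrossingPairs := by
    exact_mod_cast D.sum_Cg
  simp only [h1, Nat.cast_ofNat]
  rw [← mul_sum, h2]
  push_cast
  ring

lemma restrict_deg (S : Set V) (e : (G.induce S).edgeSet) :
    ((D.restrict S).Cg.neighborSet e).ncard ≤ (D.Cg.neighborSet (emap G S e)).ncard := by
  classical
  rw [← Set.ncard_image_of_injective _ (emap G S).injective]
  refine Set.ncard_le_ncard ?_ (Set.toFinite _)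
  rintro _ ⟨f, hf, rfl⟩
  exact ⟨fun h => hf.1 ((emap G S).injective h), hf.2⟩

lemma restrict_le (S : Finset V) :
    ((D.restrict (S : Set V)).numCrossingPairs : ℝ) + (bds (G.induce (S : Set V)) : ℝ) ≤ ∑ v ∈ S, D.W v := by
  classical
  rw [sum_W, bds, finsum_eq_sum_of_fintype]
  have hb : ((∑ v : (S : Set V), ((G.induce (S : Set V)).neighborSet v).ncard.choose 2 : ℕ) : ℝ) ≤
      ∑ v ∈ S, (((G.neighborSet v).ncard.choose 2 : ℕ) : ℝ) := by
    have : ∑ v ∈ S, (G.neighborSet v).ncard.choose 2 =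
        ∑ v : (S : Set V), (G.neighborSet (v : V)).ncard.choose 2 :=
      (sum_coe_sort S (fun v => (G.neighborSet v).ncard.choose 2)).symm
    rw [← Nat.cast_sum, this]
    norm_cast
    refine sum_le_sum fun v _ => Nat.choose_le_choose 2 ?_
    rw [← Set.ncard_image_of_injective _ Subtype.val_injective]
    refine Set.ncard_le_ncard ?_ (Set.toFinite _)
    rintro _ ⟨u, hu, rfl⟩
    exact hu
  have hc : (4 : ℝ) * (D.restrict (S : Set V)).numCrossingPairs ≤
      ∑ e : G.edgeSet, ((S.filter (fun v => v ∈ (e : Sym2 V))).card : ℝ) *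
      ((D.Cg.neighborSet e).ncard : ℝ) := by
    have h2 : ∑ e : (G.induce (S : Set V)).edgeSet,
        (((D.restrict (S : Set V)).Cg.neighborSet e).ncard : ℝ) =
        2 * (D.restrict (S : Set V)).numCrossingPairs := by
      exact_mod_cast (D.restrict (S : Set V)).sum_Cg
    have h3 : (4 : ℝ) * (D.restrict (S : Set V)).numCrossingPairs =
      ∑ e : (G.induce (S : Set V)).edgeSet,
        2 * (((D.restrict (S : Set V)).Cg.neighborSet e).ncard : ℝ) := by
      rw [← mul_sum, h2]; ring
    rw [h3]
    calc _ ≤ ∑ e : (G.induce (S : Set V)).edgeSet,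
        ((S.filter (fun v => v ∈ ((emap G (S : Set V) e : G.edgeSet) : Sym2 V))).card : ℝ) *
      ((D.Cg.neighborSet (emap G (S : Set V) e)).ncard : ℝ) := by
          refine sum_le_sum fun e _ => ?_
          have h4 : (S.filter (fun v => v ∈ ((emap G (S : Set V) e : G.edgeSet) : Sym2 V))).card = 2 := by
            rw [emap_val]
            obtain ⟨e, he⟩ := e
            induction e with
            | _ a b =>
              have hne : a ≠ b := (G.induce (S : Set V)).ne_of_adj he
              have hne' : (a : V) ≠ b := fun h => hne (Subtype.ext h)
              rw [← card_pair hne']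
              congr 1
              ext v
              have ha : (a : V) ∈ S := a.2
              have hb : (b : V) ∈ S := b.2
              simp only [mem_filter, Sym2.map_mk, Sym2.mem_iff, mem_insert, mem_singleton]
              constructor
              · exact fun h => h.2
              · rintro (rfl | rfl)
                · exact ⟨ha, .inl rfl⟩
                · exact ⟨hb, .inr rfl⟩
          rw [h4]
          have := D.restrict_deg (S : Set V) e
          have : (((D.restrict (S : Set V)).Cg.neighborSet e).ncard : ℝ) ≤
            ((D.Cg.neighborSet (emap G (S : Set V) e)).ncard : ℝ) := by exact_mod_cast this
          push_cast
          linarith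
      _ = ∑ e ∈ univ.map (emap G (S : Set V)), ((S.filter (fun v => v ∈ (e : Sym2 V))).card : ℝ) *
      ((D.Cg.neighborSet e).ncard : ℝ) := by rw [sum_map]
      _ ≤ _ := sum_le_sum_of_subset_of_nonneg (subset_univ _) fun e _ _ => by positivity
  linarith

lemma induce_le (S : Finset V) :
    (pcrNum (G.induce (S : Set V)) : ℝ) + (bds (G.induce (S : Set V)) : ℝ) ≤ ∑ v ∈ S, D.W v := by
  have h : pcrNum (G.induce (S : Set V)) ≤ (D.restrict (S : Set V)).numCrossingPairs :=
    Nat.sInf_le ⟨_, rfl⟩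
  have h' : (pcrNum (G.induce (S : Set V)) : ℝ) ≤ (D.restrict (S : Set V)).numCrossingPairs := by
    exact_mod_cast h
  linarith [D.restrict_le S]

lemma touch_card :
    {t : G.edgeSet × G.edgeSet | t.1 ≠ t.2 ∧
      (D.curve t.1 '' Set.Icc 0 1 ∩ D.curve t.2 '' Set.Icc 0 1).Nonempty}.ncard ≤
      2 * (D.numCrossingPairs + bds G) := by
  classical
  have hsub : {t : G.edgeSet × G.edgeSet | t.1 ≠ t.2 ∧
      (D.curve t.1 '' Set.Icc 0 1 ∩ D.curve t.2 '' Set.Icc 0 1).Nonempty} ⊆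
      (↑((univ.sigma fun e : G.edgeSet => (D.Cg.neighborSet e).toFinset).image
          (fun x => ((x.1, x.2) : G.edgeSet × G.edgeSet)) ∪
        (univ : Finset V).biUnion fun v =>
          ((univ : Finset G.edgeSet).filter (fun e : G.edgeSet => v ∈ (e : Sym2 V))).offDiag) : Set _) := by
    rintro ⟨e, f⟩ ⟨hne, h⟩
    rw [Finset.mem_coe, mem_union]
    rcases D.touch_cases e f hne h with h | ⟨v, h1, h2⟩
    · refine .inl (mem_image.2 ⟨⟨e, f⟩, ?_, rfl⟩)
      simp only [mem_sigma, Finset.mem_univ, true_and, Set.mem_toFinset]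
      exact h
    · refine .inr (mem_biUnion.2 ⟨v, Finset.mem_univ _, ?_⟩)
      simp only [mem_offDiag, mem_filter, Finset.mem_univ, true_and]
      exact ⟨h1, h2, hne⟩
  refine (Set.ncard_le_ncard hsub (Set.toFinite _)).trans ?_
  rw [Set.ncard_coe_finset]
  refine (card_union_le _ _).trans ?_
  rw [mul_add]
  refine add_le_add ?_ ?_
  · refine card_image_le.trans ?_
    rw [card_sigma, ← D.sum_Cg]
    refine sum_le_sum fun e _ => ?_
    rw [Set.ncard_eq_toFinset_card']
  · refine card_biUnion_le.trans ?_
    rw [bds, finsum_eq_sum_of_fintype, mul_sum]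
    refine sum_le_sum fun v _ => ?_
    rw [offDiag_card, inc_card, Nat.choose_two_right]
    set d := (G.neighborSet v).ncard
    have : 2 ∣ d * (d - 1) := (Nat.even_mul_pred_self d).two_dvd
    rw [Nat.mul_div_cancel' this, Nat.mul_sub, mul_one]

end Drawing


namespace Drawing
open Finset

/-- edges leaving a vertex set -/
def ecut {V : Type} (G : SimpleGraph V) (R : Finset V) : Set (Sym2 V) :=
  {e : Sym2 V | e ∈ G.edgeSet ∧ ∃ u v, e = s(u, v) ∧ u ∈ R ∧ v ∉ R}

lemma step {V : Type} [Fintype V] [DecidableEq V] {G : SimpleGraph V} (D : Drawing G) (M : ℝ) (hM : 0 < M)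
    (hMW : ∑ v, D.W v = M) (hsmall : ∀ v, D.W v < M / 4) (R : Finset V)
    (hR : ((ecut G R).ncard : ℝ) * M ≤ 400000 * √M * ∑ v ∈ R, D.W v)
    (hbig : 3 / 4 * M < ∑ v ∈ Rᶜ, D.W v) :
    ∃ R' : Finset V, R.card < R'.card ∧ ∑ v ∈ R', D.W v ≤ 5 / 8 * M ∧
      ((ecut G R').ncard : ℝ) * M ≤ 400000 * √M * ∑ v ∈ R', D.W v := by
  classical
  set U : Finset V := Rᶜ with hU
  set WU := ∑ v ∈ U, D.W v with hWU
  have hWU0 : 0 < WU := by linarith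
  have hRU : ∑ v ∈ R, D.W v + WU = M := by rw [← hMW]; exact sum_add_sum_compl R D.W
  have hsumU : ∑ v : (U : Set V), D.W v = WU := sum_coe_sort U D.W
  obtain ⟨A, hA0, hA1, hA2⟩ := (D.restrict (U : Set V)).drawing_cut (fun v => D.W v / WU)
    (fun v => div_nonneg (D.W_nonneg v) hWU0.le)
    (by rw [← sum_div, hsumU]; exact div_self hWU0.ne')
    (by
      intro v
      rw [div_le_iff₀ hWU0]
      linarith [hsmall v])
  rw [← sum_div] at hA1 hA2
  set WA := ∑ v ∈ A, D.W v with hWA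
  have hWA0 : 0 ≤ WA := sum_nonneg fun v _ => D.W_nonneg v
  set A' : Finset V := A.map (Function.Embedding.subtype _) with hA'
  have hA'U : ∀ v ∈ A', v ∉ R := by
    intro v hv
    rw [hA', mem_map] at hv
    obtain ⟨⟨x, hx⟩, -, rfl⟩ := hv
    have : x ∈ U := hx
    rw [hU, mem_compl] at this
    exact this
  have hdisj : Disjoint R A' := Finset.disjoint_left.2 fun v h1 h2 => hA'U v h2 h1
  have hWA' : ∑ v ∈ A', D.W v = WA := by rw [hA', sum_map]; rfl
  have hWRA : ∑ v ∈ R ∪ A', D.W v = ∑ v ∈ R, D.W v + WA := by rw [sum_union hdisj, hWA']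
  have hA1' : WA ≤ 1 / 2 * WU := by rwa [div_le_iff₀ hWU0] at hA1
  refine ⟨R ∪ A', ?_, ?_, ?_⟩
  · rw [card_union_of_disjoint hdisj, hA', card_map]
    have := hA0.card_pos
    omega
  · rw [hWRA]; linarith
  · rw [hWRA]
    have hsub : ecut G (R ∪ A') ⊆ ecut G R ∪ (Sym2.map Subtype.val) ''
        {e : Sym2 (U : Set V) | e ∈ (G.induce (U : Set V)).edgeSet ∧
          ∃ u v, e = s(u, v) ∧ u ∈ A ∧ v ∉ A} := by
      rintro _ ⟨he, u, v, rfl, hu, hv⟩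
      rw [mem_union, not_or] at hv
      rw [mem_union] at hu
      rcases hu with hu | hu
      · exact .inl ⟨he, u, v, rfl, hu, hv.1⟩
      · rw [hA', mem_map] at hu
        obtain ⟨u, hu, rfl⟩ := hu
        have hvU : v ∈ (U : Set V) := by
          show v ∈ U
          rw [hU, mem_compl]; exact hv.1
        refine .inr ⟨s(u, ⟨v, hvU⟩), ⟨he, u, ⟨v, hvU⟩, rfl, hu, ?_⟩, rfl⟩
        intro hvA
        exact hv.2 (by rw [hA', mem_map]; exact ⟨_, hvA, rfl⟩)
    have h1 := ((Set.ncard_le_ncard hsub (Set.toFinite _)).trans (Set.ncard_union_le _ _)).trans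
      (Nat.add_le_add_left (Set.ncard_image_le (Set.toFinite _)) _)
    set K := {e : Sym2 (U : Set V) | e ∈ (G.induce (U : Set V)).edgeSet ∧
          ∃ u v, e = s(u, v) ∧ u ∈ A ∧ v ∉ A}.ncard with hK
    have h1' : ((ecut G (R ∪ A')).ncard : ℝ) ≤ (ecut G R).ncard + K := by exact_mod_cast h1
    have ht := (D.restrict (U : Set V)).touch_card
    set T := {t : (G.induce (U : Set V)).edgeSet × (G.induce (U : Set V)).edgeSet | t.1 ≠ t.2 ∧
      ((D.restrict (U : Set V)).curve t.1 '' Set.Icc 0 1 ∩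
        (D.restrict (U : Set V)).curve t.2 '' Set.Icc 0 1).Nonempty}.ncard with hT
    have ht' : (T : ℝ) ≤ 2 * M := by
      have h2 : (T : ℝ) ≤ 2 * ((D.restrict (U : Set V)).numCrossingPairs + bds (G.induce (U : Set V))) := by
        exact_mod_cast ht
      have h3 := D.restrict_le U
      have h4 : 0 ≤ ∑ v ∈ R, D.W v := sum_nonneg fun v _ => D.W_nonneg v
      linarith
    have hsq : √(T : ℝ) ≤ 3 / 2 * √M := by
      rw [Real.sqrt_le_left (by positivity), mul_pow, Real.sq_sqrt hM.le]
      linarith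
    have hfr : WA / WU * M ≤ 4 / 3 * WA := by
      rw [div_mul_eq_mul_div, div_le_iff₀ hWU0]
      nlinarith
    have hKM : (K : ℝ) * M ≤ 400000 * √M * WA := by
      calc (K : ℝ) * M ≤ (200000 * √(T : ℝ) * (WA / WU)) * M := mul_le_mul_of_nonneg_right hA2 hM.le
        _ = 200000 * √(T : ℝ) * (WA / WU * M) := by ring
        _ ≤ 200000 * (3 / 2 * √M) * (4 / 3 * WA) := by gcongr
        _ = _ := by ring
    nlinarith

theorem main {n : ℕ} (G : SimpleGraph (Fin n)) (M : ℝ) (hMe : M = (pcrNum G : ℝ) + (bds G : ℝ)) :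
    ∃ R : Finset (Fin n), ((ecut G R).ncard : ℝ) ≤ 400000 * √M ∧
      (pcrNum (G.induce (R : Set (Fin n))) : ℝ) + (bds (G.induce (R : Set (Fin n))) : ℝ) ≤ 3 / 4 * M ∧
      (pcrNum (G.induce ((R : Set (Fin n))ᶜ)) : ℝ) + (bds (G.induce ((R : Set (Fin n))ᶜ)) : ℝ) ≤
        3 / 4 * M := by
  classical
  obtain ⟨D0⟩ := DrawEx.exists_drawing G
  obtain ⟨D, hD⟩ : ∃ D : Drawing G, D.numCrossingPairs = pcrNum G :=
    Nat.sInf_mem (s := {n | ∃ D : Drawing G, D.numCrossingPairs = n}) ⟨_, D0, rfl⟩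
  have hMW : ∑ v, D.W v = M := by rw [D.sum_W_univ, hD, hMe]
  have hW0 : ∀ S : Finset (Fin n), 0 ≤ ∑ v ∈ S, D.W v := fun S => sum_nonneg fun v _ => D.W_nonneg v
  have hcompl : ∀ S : Finset (Fin n), ∑ v ∈ S, D.W v + ∑ v ∈ Sᶜ, D.W v = M := fun S => by
    rw [← hMW]; exact sum_add_sum_compl S D.W
  have hind : ∀ R : Finset (Fin n), (pcrNum (G.induce ((R : Set (Fin n))ᶜ)) : ℝ) +
      (bds (G.induce ((R : Set (Fin n))ᶜ)) : ℝ) ≤ ∑ v ∈ Rᶜ, D.W v := by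
    intro R
    have := D.induce_le Rᶜ
    rwa [coe_compl] at this
  have hM0 : 0 ≤ M := by rw [← hMW]; exact hW0 _
  have hcut0 : ecut G (∅ : Finset (Fin n)) = ∅ := by
    ext e; simp [ecut]
  rcases hM0.eq_or_lt with hM | hM
  · refine ⟨∅, ?_, ?_, ?_⟩
    · rw [hcut0]; simp
    · refine (D.induce_le ∅).trans ?_
      rw [← hM]; simp
    · refine (hind ∅).trans ?_
      have := hcompl ∅
      rw [sum_empty] at this
      linarith
  by_cases hv : ∃ v, M / 4 ≤ D.W v
  · obtain ⟨v, hv⟩ := hv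
    have hM1 : 1 ≤ M := by
      have h : (0 : ℝ) < ((pcrNum G + bds G : ℕ) : ℝ) := by push_cast; linarith
      have h' : 1 ≤ pcrNum G + bds G := by exact_mod_cast h
      have h2 : (1 : ℝ) ≤ ((pcrNum G + bds G : ℕ) : ℝ) := by exact_mod_cast h'
      push_cast at h2; linarith
    refine ⟨{v}, ?_, ?_, ?_⟩
    · have h1 : (ecut G {v}).ncard ≤ (G.neighborSet v).ncard := by
        have : (G.neighborSet v).ncard = (G.incidenceSet v).ncard :=
          (Nat.card_congr (G.incidenceSetEquivNeighborSet v)).symm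
        rw [this]
        refine Set.ncard_le_ncard ?_ (Set.toFinite _)
        rintro _ ⟨he, a, b, rfl, ha, hb⟩
        rw [mem_singleton] at ha
        subst ha
        exact ⟨he, by simp⟩
      have h2 : (((G.neighborSet v).ncard.choose 2 : ℕ) : ℝ) ≤ M := by
        have h3 : bds G = ∑ v, (G.neighborSet v).ncard.choose 2 := by
          rw [bds, finsum_eq_sum_of_fintype]
        have h4 : (G.neighborSet v).ncard.choose 2 ≤ bds G := by
          rw [h3]
          exact single_le_sum (f := fun v => (G.neighborSet v).ncard.choose 2)
            (fun _ _ => Nat.zero_le _) (mem_univ v)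
        have h5 : (((G.neighborSet v).ncard.choose 2 : ℕ) : ℝ) ≤ bds G := by exact_mod_cast h4
        have h6 : (0 : ℝ) ≤ pcrNum G := Nat.cast_nonneg _
        linarith
      have h1' : ((ecut G {v}).ncard : ℝ) ≤ (G.neighborSet v).ncard := by exact_mod_cast h1
      refine h1'.trans ?_
      rw [Nat.cast_choose_two] at h2
      set d : ℝ := ((G.neighborSet v).ncard : ℝ)
      have hs : 1 ≤ √M := by rw [Real.one_le_sqrt]; exact hM1
      have hs2 := Real.sq_sqrt hM0
      by_contra hcon
      push Not at hcon
      nlinarith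
    · have hbot : ∑ v' : (({v} : Finset (Fin n)) : Set (Fin n)), 0 = 0 := by simp
      have h0 : (G.induce ((({v} : Finset (Fin n))) : Set (Fin n))) = ⊥ := by
        ext ⟨a, ha⟩ ⟨b, hb⟩
        simp only [coe_singleton, Set.mem_singleton_iff] at ha hb
        subst ha hb
        simp
      have hp : pcrNum (G.induce ((({v} : Finset (Fin n))) : Set (Fin n))) = 0 := by
        have h1 : pcrNum (G.induce ((({v} : Finset (Fin n))) : Set (Fin n))) ≤
          (D.restrict (({v} : Finset (Fin n)) : Set (Fin n))).numCrossingPairs := Nat.sInf_le ⟨_, rfl⟩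
        have h2 : (D.restrict (({v} : Finset (Fin n)) : Set (Fin n))).crossingPairs = ∅ := by
          ext x
          simp only [Set.mem_empty_iff_false, iff_false]
          rintro ⟨⟨e, he⟩, -⟩
          rw [h0] at he
          simp at he
        rw [numCrossingPairs, h2] at h1
        simpa using h1
      have hb : bds (G.induce ((({v} : Finset (Fin n))) : Set (Fin n))) = 0 := by
        rw [bds, h0]
        have : ∀ u, ((⊥ : SimpleGraph (({v} : Finset (Fin n)) : Set (Fin n))).neighborSet u) = ∅ := by
          intro u; ext; simp
        simp [this]
      rw [hp, hb]
      norm_num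
      exact hM0
    · refine (hind {v}).trans ?_
      have := hcompl {v}
      rw [sum_singleton] at this
      linarith
  push Not at hv
  let good : Finset (Finset (Fin n)) := univ.filter fun R => ∑ v ∈ R, D.W v ≤ 5 / 8 * M ∧
      ((ecut G R).ncard : ℝ) * M ≤ 400000 * √M * ∑ v ∈ R, D.W v
  have hgood : good.Nonempty := by
    refine ⟨∅, ?_⟩
    simp only [good, mem_filter, mem_univ, true_and, hcut0, sum_empty]
    refine ⟨by positivity, by simp⟩
  obtain ⟨R, hR, hmax⟩ := good.exists_max_image card hgood
  simp only [good, mem_filter, mem_univ, true_and] at hR hmax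
  have hfin : ∑ v ∈ Rᶜ, D.W v ≤ 3 / 4 * M := by
    by_contra hcon
    push Not at hcon
    obtain ⟨R', h1, h2, h3⟩ := step D M hM hMW hv R hR.2 hcon
    exact absurd (hmax R' ⟨h2, h3⟩) (by omega)
  refine ⟨R, ?_, (D.induce_le R).trans (by linarith [hR.1]), (hind R).trans hfin⟩
  have h1 : ((ecut G R).ncard : ℝ) * M ≤ (400000 * √M) * M := by
    refine hR.2.trans ?_
    gcongr
    linarith [hR.1]
  exact le_of_mul_le_mul_right h1 hM

end Drawing

/-- There is an absolute constant `c > 0` such that every simple graph `G` can be split, by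
removing at most `c·sqrt(pcr(G) + bds(G))` edges, into two induced subgraphs `G₁`, `G₂`
(on complementary vertex sets) with `pcr(Gᵢ) + bds(Gᵢ) ≤ (3/4)(pcr(G) + bds(G))`. -/
theorem partition_pcr_bds :
    ∃ c : ℝ, 0 < c ∧ ∀ (n : ℕ) (G : SimpleGraph (Fin n)),
      ∃ (V1 : Set (Fin n)) (F : Set (Sym2 (Fin n))),
        F ⊆ G.edgeSet ∧
        (F.ncard : ℝ) ≤ c * Real.sqrt ((pcrNum G : ℝ) + (bds G : ℝ)) ∧
        (∀ e ∈ G.edgeSet, (∃ u v : Fin n, e = s(u, v) ∧ u ∈ V1 ∧ v ∉ V1) → e ∈ F) ∧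
        ((pcrNum (G.induce V1) : ℝ) + (bds (G.induce V1) : ℝ)
          ≤ (3/4) * ((pcrNum G : ℝ) + (bds G : ℝ))) ∧
        ((pcrNum (G.induce V1ᶜ) : ℝ) + (bds (G.induce V1ᶜ) : ℝ)
          ≤ (3/4) * ((pcrNum G : ℝ) + (bds G : ℝ))) := by
  refine ⟨400000, by norm_num, fun n G => ?_⟩
  obtain ⟨R, h1, h2, h3⟩ := Drawing.main G _ rfl
  exact ⟨R, Drawing.ecut G R, fun e he => he.1, h1, fun e he ⟨u, v, h, hu, hv⟩ => ⟨he, u, v, h, hu, hv⟩, h2, h3⟩
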